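/- arXiv:1010.3353 — 4 statements merged into one kernel-verified Lean document; each statement's English description precedes it below -/
import Mathlib

section
/- Under Assumption (H), if additionally esssup ξ ∈ {0, ∞} and H(t) ≠ 0 for all sufficiently large t, then H is regularly varying with index γ, i.e. for every y > 0 one has lim_{t→∞} H(ty)/H(t) = y^γ. -/
open MeasureTheory Filter
open scoped ENNReal NNReal Topology

/-- The lattice `ℤ^d`. -/
abbrev Zd (d : ℕ) := Fin d → ℤ

/-- Real power with the convention `0 ^ 0 = 0`. -/
noncomputable def mpow (x γ : ℝ) : ℝ := if x = 0 then 0 else x ^ γ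

/-- `p` is a probability measure on `ℤ^d`, identified with its mass function. -/
def IsProb {d : ℕ} (p : Zd d → ℝ) : Prop := (∀ z, 0 ≤ p z) ∧ HasSum p 1

/-- The discrete Dirichlet form `S(p) = -(Δ√p, √p)`, with values in `[0,∞]`. -/
noncomputable def dirS {d : ℕ} (p : Zd d → ℝ) : ℝ≥0∞ :=
  2⁻¹ * ∑' z : Zd d, ∑' x : Zd d,
    if (∑ i, |x i - z i|) = 1 then
      ENNReal.ofReal ((Real.sqrt (p x) - Real.sqrt (p z)) ^ 2) else 0

/-- The functional whose infimum is `χ^{DB}_γ(ρ)`. -/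
noncomputable def FDB {d : ℕ} (γ ρ : ℝ) (p : Zd d → ℝ) : ℝ≥0∞ :=
  dirS p + ∑' z : Zd d, ENNReal.ofReal (ρ / (1 - γ) * (mpow (p z) γ - p z))

noncomputable def chiDB (d : ℕ) (γ ρ : ℝ) : ℝ≥0∞ :=
  ⨅ p : {p : Zd d → ℝ // IsProb p}, FDB γ ρ p.1

/-- The functional whose infimum is `χ^{DE}(ρ)`. -/
noncomputable def FDE {d : ℕ} (ρ : ℝ) (p : Zd d → ℝ) : ℝ≥0∞ :=
  dirS p + ∑' z : Zd d, ENNReal.ofReal (-(ρ * (p z * Real.log (p z))))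

noncomputable def chiDE (d : ℕ) (ρ : ℝ) : ℝ≥0∞ :=
  ⨅ p : {p : Zd d → ℝ // IsProb p}, FDE ρ p.1

/-- Admissible test functions: smooth, compactly supported, `L²`-normalised. -/
def TestFun (d : ℕ) (g : EuclideanSpace ℝ (Fin d) → ℝ) : Prop :=
  ContDiff ℝ (⊤ : ℕ∞) g ∧ HasCompactSupport g ∧ ∫ x, (g x) ^ 2 = 1

noncomputable def chiAB (d : ℕ) (ρ : ℝ) : ℝ :=
  sInf {v : ℝ | ∃ g : EuclideanSpace ℝ (Fin d) → ℝ, TestFun d g ∧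
    v = ∫ x, ‖fderiv ℝ g x‖ ^ 2 - ρ * ∫ x, (g x) ^ 2 * Real.log ((g x) ^ 2)}

noncomputable def chiB (d : ℕ) (γ ρ : ℝ) : ℝ :=
  sInf {v : ℝ | ∃ g : EuclideanSpace ℝ (Fin d) → ℝ, TestFun d g ∧
    v = ∫ x, ‖fderiv ℝ g x‖ ^ 2 + ρ / (1 - γ) * ∫ x, (mpow ((g x) ^ 2) γ - (g x) ^ 2)}

noncomputable def chiRWRS (d : ℕ) (H : ℝ → ℝ) (θ : ℝ) : ℝ :=
  sInf {v : ℝ | ∃ g : EuclideanSpace ℝ (Fin d) → ℝ, TestFun d g ∧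
    v = ∫ x, ‖fderiv ℝ g x‖ ^ 2 - θ * ∫ x, H ((g x) ^ 2)}

/-- `f` is regularly varying (at infinity) with index `idx`. -/
def RegVary (f : ℝ → ℝ) (idx : ℝ) : Prop :=
  ∀ y : ℝ, 0 < y → Tendsto (fun t => f (t * y) / f t) atTop (𝓝 (y ^ idx))

noncomputable def hatH (γ y : ℝ) : ℝ :=
  if γ = 1 then y * Real.log y else (y - mpow y γ) / (1 - γ)

/-- Assumption (H) of the paper. -/
structure AssumptionH (H : ℝ → ℝ) (γ ρ : ℝ) (khat : ℝ → ℝ) : Prop where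
  hγ : 0 ≤ γ
  hρ : 0 < ρ
  khat_pos : ∀ t, 0 < t → 0 < khat t
  khat_cont : ContinuousOn khat (Set.Ioi 0)
  khat_rv : RegVary khat γ
  conv : ∀ K : Set ℝ, IsCompact K → K ⊆ Set.Ici 0 →
    TendstoUniformlyOn (fun t y => (H (t * y) - y * H t) / khat t)
      (fun y => ρ * hatH γ y) atTop K

/-- The discrete Laplacian on `ℤ^d`. -/
noncomputable def discLap {d : ℕ} (f : Zd d → ℝ) (z : Zd d) : ℝ :=
  ∑ i : Fin d,
    ((f (fun j => z j + if j = i then 1 else 0) - f z) +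
     (f (fun j => z j - if j = i then 1 else 0) - f z))

/-- `u` is a nonnegative solution of the PAM equation with diffusion constant `κt`,
potential `ξ` and localised initial condition. -/
def IsSolPAM {d : ℕ} (κt : ℝ) (ξ : Zd d → ℝ) (u : ℝ → Zd d → ℝ) : Prop :=
  (∀ s z, 0 ≤ u s z) ∧
  (∀ z, u 0 z = if z = 0 then 1 else 0) ∧
  (∀ s, 0 < s → ∀ z,
    HasDerivAt (fun s' => u s' z) (κt * discLap (fun x => u s x) z + ξ z * u s z) s)

/-- `u` is the minimal nonnegative solution. -/
def MinimalSol {d : ℕ} (κt : ℝ) (ξ : Zd d → ℝ) (u : ℝ → Zd d → ℝ) : Prop :=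
  IsSolPAM κt ξ u ∧ ∀ v, IsSolPAM κt ξ v → ∀ s z, u s z ≤ v s z

/-- If `|e (2t)| ≤ q |e t| + ε` for large `t`, for every `ε > 0` and some fixed `q < 1`, and `e` is
bounded on the intervals `[T, 2T]`, then `e` tends to `0`. -/
theorem tendsto_zero_of_forward_contraction {e : ℝ → ℝ} {q : ℝ} (hq0 : 0 ≤ q) (hq1 : q < 1)
    (hb : ∀ T : ℝ, 0 < T → ∃ M : ℝ, ∀ t ∈ Set.Icc T (2 * T), |e t| ≤ M)
    (he : ∀ ε : ℝ, 0 < ε → ∀ᶠ t in atTop, |e (t * 2)| ≤ q * |e t| + ε) :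
    Tendsto e atTop (𝓝 0) := by
  rw [Metric.tendsto_atTop]
  intro δ hδ
  have h1q : 0 < 1 - q := by linarith
  obtain ⟨T₀, hT₀⟩ := eventually_atTop.1 (he ((1 - q) * (δ / 2)) (by positivity))
  set T := max T₀ 1
  have hT1 : 1 ≤ T := le_max_right _ _
  have hT : 0 < T := by linarith
  obtain ⟨M, hM⟩ := hb T hT
  have hM0 : 0 ≤ M := (abs_nonneg _).trans (hM T ⟨le_rfl, by linarith⟩)
  have key : ∀ n : ℕ, ∀ t : ℝ, 2 ^ n * T ≤ t → t ≤ 2 ^ (n + 1) * T →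
      |e t| ≤ q ^ n * M + δ / 2 := by
    intro n
    induction n with
    | zero =>
      intro t h1 h2
      have := hM t ⟨by simpa using h1, by simpa using h2⟩
      simp only [pow_zero, one_mul]
      linarith
    | succ n ih =>
      intro t h1 h2
      have h1' : 2 ^ n * T ≤ t / 2 := by rw [pow_succ] at h1; linarith
      have h2' : t / 2 ≤ 2 ^ (n + 1) * T := by rw [pow_succ] at h2; linarith
      have hpow : (1 : ℝ) ≤ 2 ^ n := one_le_pow₀ (by norm_num)
      have hTt : T ≤ t / 2 := (le_mul_of_one_le_left hT.le hpow).trans h1'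
      have h3 := hT₀ (t / 2) ((le_max_left _ _).trans hTt)
      rw [div_mul_cancel₀ t two_ne_zero] at h3
      have h4 := mul_le_mul_of_nonneg_left (ih _ h1' h2') hq0
      rw [pow_succ]
      linarith
  obtain ⟨N, hN⟩ : ∃ N : ℕ, q ^ N * M < δ / 2 := by
    have : Tendsto (fun n : ℕ => q ^ n * M) atTop (𝓝 (0 * M)) :=
      (tendsto_pow_atTop_nhds_zero_of_lt_one hq0 hq1).mul_const M
    rw [zero_mul] at this
    exact (this.eventually (gt_mem_nhds (by positivity))).exists
  refine ⟨2 ^ N * T, fun t ht => ?_⟩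
  have hpow : (1 : ℝ) ≤ 2 ^ N := one_le_pow₀ (by norm_num)
  have ht1 : 2 ^ N ≤ t / T := (le_div_iff₀ hT).2 ht
  obtain ⟨n, hn1, hn2⟩ := exists_nat_pow_near (hpow.trans ht1) one_lt_two
  have hNn : N ≤ n := by
    have h := (pow_lt_pow_iff_right₀ (one_lt_two (α := ℝ))).1 (ht1.trans_lt hn2)
    omega
  have h5 := key n t ((le_div_iff₀ hT).1 hn1) ((div_lt_iff₀ hT).1 hn2).le
  have h6 := mul_le_mul_of_nonneg_right (pow_le_pow_of_le_one hq0 hq1.le hNn) hM0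
  rw [dist_zero_right, Real.norm_eq_abs]
  linarith

/-- If `e` is eventually bounded and `|e t| ≤ q |e (2t)| + ε` for large `t`, for every `ε > 0` and
some fixed `q < 1`, then `e` tends to `0`. -/
theorem tendsto_zero_of_backward_contraction {e : ℝ → ℝ} {q B : ℝ} (hq0 : 0 ≤ q) (hq1 : q < 1)
    (hb : ∀ᶠ t in atTop, |e t| ≤ B)
    (he : ∀ ε : ℝ, 0 < ε → ∀ᶠ t in atTop, |e t| ≤ q * |e (t * 2)| + ε) :
    Tendsto e atTop (𝓝 0) := by
  rw [Metric.tendsto_atTop]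
  intro δ hδ
  have h1q : 0 < 1 - q := by linarith
  obtain ⟨T, hT⟩ := eventually_atTop.1
    ((he ((1 - q) * (δ / 2)) (by positivity)).and (hb.and (eventually_ge_atTop 0)))
  have key : ∀ n : ℕ, ∀ t : ℝ, T ≤ t → |e t| ≤ q ^ n * B + δ / 2 := by
    intro n
    induction n with
    | zero =>
      intro t h1
      have := (hT t h1).2.1
      simp only [pow_zero, one_mul]
      linarith
    | succ n ih =>
      intro t h1
      obtain ⟨h2, -, h3⟩ := hT t h1
      have h4 := mul_le_mul_of_nonneg_left (ih (t * 2) (by linarith)) hq0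
      rw [pow_succ]
      linarith
  obtain ⟨N, hN⟩ : ∃ N : ℕ, q ^ N * B < δ / 2 := by
    have : Tendsto (fun n : ℕ => q ^ n * B) atTop (𝓝 (0 * B)) :=
      (tendsto_pow_atTop_nhds_zero_of_lt_one hq0 hq1).mul_const B
    rw [zero_mul] at this
    exact (this.eventually (gt_mem_nhds (by positivity))).exists
  refine ⟨T, fun t ht => ?_⟩
  rw [dist_zero_right, Real.norm_eq_abs]
  linarith [key N t ht]

/-- Below its essential supremum, `c` bounds `H t / t` from below up to `O(1 / t)`. -/
theorem eventually_mul_le_log_integral_exp {Ω : Type*} [MeasurableSpace Ω] (P : Measure Ω)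
    [IsProbabilityMeasure P] {ξ : Ω → ℝ}
    (hint : ∀ t : ℝ, 0 < t → Integrable (fun ω => Real.exp (t * ξ ω)) P) {c d : ℝ}
    (hc : (c : EReal) < essSup (fun ω => (ξ ω : EReal)) P) (hd : d < c) :
    ∀ᶠ t in atTop, d * t ≤ Real.log (∫ ω, Real.exp (t * ξ ω) ∂P) := by
  have hpos : 0 < P.real {ω | c ≤ ξ ω} := by
    rw [measureReal_def, ENNReal.toReal_pos_iff]
    refine ⟨pos_iff_ne_zero.2 fun h0 => ?_, measure_lt_top _ _⟩
    refine hc.not_ge (essSup_le_of_ae_le _ ?_)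
    have : ∀ᵐ ω ∂P, ¬ c ≤ ξ ω := by rw [ae_iff]; simpa using h0
    filter_upwards [this] with ω hω
    exact EReal.coe_le_coe_iff.2 (not_le.1 hω).le
  set p := P.real {ω | c ≤ ξ ω}
  filter_upwards [eventually_gt_atTop 0, eventually_ge_atTop (-Real.log p / (c - d))] with t ht ht'
  have h1 := ProbabilityTheory.measure_ge_le_exp_cgf (μ := P) (X := ξ) c ht.le (hint t ht)
  have h2 := (Real.log_le_iff_le_exp hpos).2 h1
  rw [div_le_iff₀ (by linarith)] at ht'
  have h3 : ProbabilityTheory.cgf ξ P t = Real.log (∫ ω, Real.exp (t * ξ ω) ∂P) := rfl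
  rw [h3] at h2
  linarith

/-- The log-moment generating function of a nonpositive random variable is nonpositive. -/
theorem log_integral_exp_nonpos {Ω : Type*} [MeasurableSpace Ω] (P : Measure Ω)
    [IsProbabilityMeasure P] {ξ : Ω → ℝ}
    (hint : ∀ t : ℝ, 0 < t → Integrable (fun ω => Real.exp (t * ξ ω)) P)
    (h0 : essSup (fun ω => (ξ ω : EReal)) P = 0) {t : ℝ} (ht : 0 < t) :
    Real.log (∫ ω, Real.exp (t * ξ ω) ∂P) ≤ 0 := by
  refine Real.log_nonpos (integral_nonneg fun _ => (Real.exp_pos _).le) ?_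
  calc ∫ ω, Real.exp (t * ξ ω) ∂P ≤ ∫ _, (1 : ℝ) ∂P := by
        refine integral_mono_ae (hint t ht) (integrable_const _) ?_
        filter_upwards [ae_le_essSup (f := fun ω => (ξ ω : EReal)) (μ := P)] with ω hω
        rw [h0] at hω
        have : ξ ω ≤ 0 := by exact_mod_cast hω
        exact Real.exp_le_one_iff.2 (mul_nonpos_of_nonneg_of_nonpos ht.le this)
    _ = 1 := by simp

/-- The log-moment generating function is continuous on `(0, ∞)`. -/
theorem continuousOn_log_integral_exp {Ω : Type*} [MeasurableSpace Ω] (P : Measure Ω)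
    {ξ : Ω → ℝ} (hint : ∀ t : ℝ, 0 < t → Integrable (fun ω => Real.exp (t * ξ ω)) P) :
    ContinuousOn (fun t => Real.log (∫ ω, Real.exp (t * ξ ω) ∂P)) (Set.Ioi 0) :=
  (ProbabilityTheory.analyticOn_cgf (X := ξ) (μ := P)).continuousOn.mono
    (interior_maximal (fun t ht => hint t ht) isOpen_Ioi)

theorem tendsto_of_assumptionH {H khat : ℝ → ℝ} {γ ρ : ℝ} (hH : AssumptionH H γ ρ khat) {y : ℝ}
    (hy : 0 ≤ y) :
    Tendsto (fun t => (H (t * y) - y * H t) / khat t) atTop (𝓝 (ρ * hatH γ y)) :=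
  (hH.conv {y} isCompact_singleton (Set.singleton_subset_iff.2 hy)).tendsto_at
    (Set.mem_singleton y)

theorem sub_one_mul_hatH {γ y : ℝ} (hy : 0 < y) : (γ - 1) * hatH γ y = y ^ γ - y := by
  unfold hatH
  split_ifs with h
  · simp [h]
  · have : 1 - γ ≠ 0 := sub_ne_zero.2 (Ne.symm h)
    rw [mpow, if_neg hy.ne']
    field_simp
    ring

/-- It suffices to identify the limit of `khat / H`. -/
theorem regVary_of_tendsto_div {H khat : ℝ → ℝ} {γ ρ : ℝ} (hH : AssumptionH H γ ρ khat)
    (hne : ∀ᶠ t in atTop, H t ≠ 0)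
    (h : Tendsto (fun t => khat t / H t) atTop (𝓝 ((γ - 1) / ρ))) : RegVary H γ := by
  intro y hy
  have h1 := ((tendsto_of_assumptionH hH hy.le).mul h).const_add y
  have hρ := hH.hρ.ne'
  have h2 : y + ρ * hatH γ y * ((γ - 1) / ρ) = y ^ γ := by
    have := sub_one_mul_hatH (γ := γ) hy
    field_simp
    linarith
  rw [h2] at h1
  refine h1.congr' ?_
  filter_upwards [hne, eventually_gt_atTop 0] with t ht ht0
  have := (hH.khat_pos t ht0).ne'
  field_simp
  ring

theorem regVary_of_tendsto_div_of_ne_one {H khat : ℝ → ℝ} {γ ρ : ℝ} (hH : AssumptionH H γ ρ khat)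
    (hne : ∀ᶠ t in atTop, H t ≠ 0) (hγ : γ ≠ 1)
    (h : Tendsto (fun t => H t / khat t - ρ / (γ - 1)) atTop (𝓝 0)) : RegVary H γ := by
  refine regVary_of_tendsto_div hH hne ?_
  have h1 := (h.add_const (ρ / (γ - 1))).inv₀
    (by rw [zero_add]; exact div_ne_zero hH.hρ.ne' (sub_ne_zero.2 hγ))
  simpa using h1

/-- The critical index: `H` has a constant sign at infinity, which forces `khat = o(H)`. -/
theorem regVary_one {H khat : ℝ → ℝ} {ρ : ℝ} (hH : AssumptionH H 1 ρ khat)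
    (hne : ∀ᶠ t in atTop, H t ≠ 0)
    (hsign : (∀ᶠ t in atTop, H t ≤ 0) ∨ (∀ᶠ t in atTop, 0 ≤ H t)) : RegVary H 1 := by
  refine regVary_of_tendsto_div hH hne ?_
  have hρ := hH.hρ
  have hhat : ∀ y, hatH 1 y = y * Real.log y := fun y => by simp [hatH]
  suffices h : Tendsto (fun t => H t / khat t) atTop atBot ∨
      Tendsto (fun t => H t / khat t) atTop atTop by
    rw [sub_self, zero_div]
    rcases h with h | h
    · exact h.inv_tendsto_atBot.congr fun t => inv_div _ _
    · exact h.inv_tendsto_atTop.congr fun t => inv_div _ _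
  rcases hsign with hs | hs
  · left
    refine tendsto_atBot.2 fun b => ?_
    set y := Real.exp ((1 - b) / ρ)
    have hy : 0 < y := Real.exp_pos _
    have hlim : ρ * hatH 1 y = y * (1 - b) := by
      rw [hhat, Real.log_exp]; field_simp
    have h1 := tendsto_of_assumptionH hH hy.le
    rw [hlim] at h1
    have h2 := h1.eventually (lt_mem_nhds (show y * (-b) < y * (1 - b) by nlinarith))
    have h3 := (tendsto_id.atTop_mul_const hy).eventually hs
    filter_upwards [h2, h3, eventually_gt_atTop 0] with t h2 h3 ht
    have hk := hH.khat_pos t ht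
    rw [lt_div_iff₀ hk] at h2
    rw [div_le_iff₀ hk]
    simp only [id] at h3
    refine le_of_mul_le_mul_left ?_ hy
    linarith
  · right
    refine tendsto_atTop.2 fun b => ?_
    set y := Real.exp (-(b + 1) / ρ)
    have hy : 0 < y := Real.exp_pos _
    have hlim : ρ * hatH 1 y = y * (-(b + 1)) := by
      rw [hhat, Real.log_exp]; field_simp
    have h1 := tendsto_of_assumptionH hH hy.le
    rw [hlim] at h1
    have h2 := h1.eventually (gt_mem_nhds (show y * (-(b + 1)) < y * (-b) by nlinarith))
    have h3 := (tendsto_id.atTop_mul_const hy).eventually hs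
    filter_upwards [h2, h3, eventually_gt_atTop 0] with t h2 h3 ht
    have hk := hH.khat_pos t ht
    rw [div_lt_iff₀ hk] at h2
    rw [le_div_iff₀ hk]
    simp only [id] at h3
    refine le_of_mul_le_mul_left ?_ hy
    linarith

/-- The limit of the increments `(H (2t) - 2 H t) / (2 khat t)`, for `γ ≠ 1`. -/
theorem tendsto_doubling_increment {H khat : ℝ → ℝ} {γ ρ : ℝ} (hH : AssumptionH H γ ρ khat)
    (hγ : γ ≠ 1) :
    Tendsto (fun t => (H (t * 2) - 2 * H t) / khat t / 2) atTop
      (𝓝 (ρ / (γ - 1) * (2 ^ γ / 2 - 1))) := by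
  have h := (tendsto_of_assumptionH hH zero_le_two).div_const 2
  have h1 : γ - 1 ≠ 0 := sub_ne_zero.2 hγ
  have h2 := sub_one_mul_hatH (γ := γ) (y := 2) two_pos
  have h3 : ρ * hatH γ 2 / 2 = ρ / (γ - 1) * (2 ^ γ / 2 - 1) := by
    have h4 : hatH γ 2 = (2 ^ γ - 2) / (γ - 1) := by rw [← h2]; field_simp
    rw [h4]; field_simp
  rwa [h3] at h

/-- With `a = H / khat` and `L = ρ / (γ - 1)`, the defect in the recursion
`(a (2t) - L) r(t) = a t - L` for `r(t) = khat (2t) / (2 khat t)` tends to zero. -/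
theorem exists_doubling_defect {H khat : ℝ → ℝ} {γ ρ : ℝ} (hH : AssumptionH H γ ρ khat)
    (hγ : γ ≠ 1) :
    ∃ w : ℝ → ℝ, Tendsto w atTop (𝓝 0) ∧ ∀ t, 0 < t →
      (H (t * 2) / khat (t * 2) - ρ / (γ - 1)) * (khat (t * 2) / khat t / 2) =
        H t / khat t - ρ / (γ - 1) + w t := by
  have hr : Tendsto (fun t => khat (t * 2) / khat t / 2) atTop (𝓝 (2 ^ γ / 2)) :=
    (hH.khat_rv 2 two_pos).div_const 2
  refine ⟨fun t => ρ / (γ - 1) + (H (t * 2) - 2 * H t) / khat t / 2 -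
    ρ / (γ - 1) * (khat (t * 2) / khat t / 2), ?_, fun t ht => ?_⟩
  · have h := ((tendsto_doubling_increment hH hγ).const_add (ρ / (γ - 1))).sub
      (hr.const_mul (ρ / (γ - 1)))
    convert h using 2
    ring
  · have h1 := (hH.khat_pos t ht).ne'
    have h2 := (hH.khat_pos (t * 2) (by linarith)).ne'
    set L := ρ / (γ - 1)
    field_simp
    ring

theorem regVary_of_one_lt {H khat : ℝ → ℝ} {γ ρ : ℝ} (hH : AssumptionH H γ ρ khat)
    (hne : ∀ᶠ t in atTop, H t ≠ 0) (hγ : 1 < γ) (hcont : ContinuousOn H (Set.Ioi 0)) :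
    RegVary H γ := by
  refine regVary_of_tendsto_div_of_ne_one hH hne hγ.ne' ?_
  obtain ⟨w, hw, hrec⟩ := exists_doubling_defect hH hγ.ne'
  have hr : Tendsto (fun t => khat (t * 2) / khat t / 2) atTop (𝓝 (2 ^ γ / 2)) :=
    (hH.khat_rv 2 two_pos).div_const 2
  have hr1 : (1 : ℝ) < 2 ^ γ / 2 := by
    have := Real.rpow_lt_rpow_of_exponent_lt one_lt_two hγ
    rw [Real.rpow_one] at this
    linarith
  obtain ⟨s, hs1, hs2⟩ := exists_between hr1
  have hs0 : 0 < s := by linarith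
  refine tendsto_zero_of_forward_contraction (q := s⁻¹) (inv_nonneg.2 hs0.le)
    (inv_lt_one_of_one_lt₀ hs1) (fun T hT => ?_) (fun ε hε => ?_)
  · have hsub : Set.Icc T (2 * T) ⊆ Set.Ioi 0 := fun t ht => hT.trans_le ht.1
    have hc : ContinuousOn (fun t => H t / khat t - ρ / (γ - 1)) (Set.Icc T (2 * T)) :=
      ((hcont.mono hsub).div (hH.khat_cont.mono hsub)
        fun t ht => (hH.khat_pos t (hsub ht)).ne').sub continuousOn_const
    obtain ⟨M, hM⟩ := isCompact_Icc.exists_bound_of_continuousOn hc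
    exact ⟨M, hM⟩
  · have hwe : ∀ᶠ t in atTop, |w t| < ε := by
      simpa using (hw.abs).eventually (gt_mem_nhds (by simpa using hε))
    filter_upwards [hwe, hr.eventually (lt_mem_nhds hs2), eventually_gt_atTop 0] with t h1 h2 ht
    have h3 := hrec t ht
    set e2 := H (t * 2) / khat (t * 2) - ρ / (γ - 1)
    set e1 := H t / khat t - ρ / (γ - 1)
    set r := khat (t * 2) / khat t / 2
    have h4 : |e2| * r ≤ |e1| + |w t| := by
      rw [← abs_of_pos (hs0.trans h2), ← abs_mul, h3]
      exact abs_add_le _ _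
    have h5 : |e2| * s ≤ |e1| + ε := by
      linarith [mul_le_mul_of_nonneg_left h2.le (abs_nonneg e2)]
    calc |e2| ≤ (|e1| + ε) / s := (le_div_iff₀ hs0).2 h5
      _ = s⁻¹ * |e1| + ε / s := by field_simp
      _ ≤ s⁻¹ * |e1| + ε := by gcongr; exact div_le_self hε.le hs1.le

/-- For `γ < 1`, the increments of `H t / t` along doublings are summable, with sum controlled by
`khat t / t`. -/
theorem exists_div_pow_two_le {H khat : ℝ → ℝ} {γ ρ : ℝ} (hH : AssumptionH H γ ρ khat)
    (hγ : γ < 1) :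
    ∃ K : ℝ, ∀ᶠ t in atTop, ∀ n : ℕ, H (t * 2 ^ n) / (t * 2 ^ n) ≤ (H t + K * khat t) / t := by
  have hr : Tendsto (fun t => khat (t * 2) / khat t / 2) atTop (𝓝 (2 ^ γ / 2)) :=
    (hH.khat_rv 2 two_pos).div_const 2
  have hr1 : (2 : ℝ) ^ γ / 2 < 1 := by
    have := Real.rpow_lt_rpow_of_exponent_lt one_lt_two hγ
    rw [Real.rpow_one] at this
    linarith
  obtain ⟨s, hs1, hs2⟩ := exists_between hr1
  have h1s : 0 < 1 - s := by linarith
  set d := ρ / (γ - 1) * ((2 : ℝ) ^ γ / 2 - 1)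
  have hd := (tendsto_doubling_increment hH hγ.ne).eventually (gt_mem_nhds (lt_add_one d))
  set C := |d + 1|
  set K := C / (1 - s) with hK
  have hK0 : 0 ≤ K := by positivity
  have hKC : C + K * s = K := by rw [hK]; field_simp; ring
  obtain ⟨T, hT⟩ := eventually_atTop.1
    ((hd.and (hr.eventually (gt_mem_nhds hs1))).and (eventually_gt_atTop 0))
  have hstep : ∀ t, T ≤ t → (H (t * 2) + K * khat (t * 2)) / (t * 2) ≤ (H t + K * khat t) / t := by
    intro t ht
    obtain ⟨⟨h1, h2⟩, ht0⟩ := hT t ht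
    have hk := hH.khat_pos t ht0
    have h3 : H (t * 2) ≤ 2 * H t + 2 * (C * khat t) := by
      have h4 := (le_abs_self (d + 1)).trans' h1.le
      rw [div_div, div_le_iff₀ (by positivity)] at h4
      linarith
    have h5 : khat (t * 2) ≤ 2 * (s * khat t) := by
      rw [div_div, div_lt_iff₀ (by positivity)] at h2
      linarith
    rw [div_le_div_iff₀ (by positivity) ht0]
    have h6 := mul_le_mul_of_nonneg_left h5 hK0
    have h7 : C * khat t + K * s * khat t = K * khat t := by rw [← add_mul, hKC]
    have h8 : H (t * 2) + K * khat (t * 2) ≤ (H t + K * khat t) * 2 := by linarith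
    calc _ ≤ (H t + K * khat t) * 2 * t := mul_le_mul_of_nonneg_right h8 ht0.le
      _ = _ := by ring
  refine ⟨K, eventually_atTop.2 ⟨T, fun t ht n => ?_⟩⟩
  have ht0 := (hT t ht).2
  have hiter : (H (t * 2 ^ n) + K * khat (t * 2 ^ n)) / (t * 2 ^ n) ≤ (H t + K * khat t) / t := by
    induction n with
    | zero => simp
    | succ n ih =>
      have hpow : (1 : ℝ) ≤ 2 ^ n := one_le_pow₀ (by norm_num)
      rw [pow_succ, ← mul_assoc]
      exact (hstep _ (ht.trans (le_mul_of_one_le_right ht0.le hpow))).trans ih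
  refine le_trans ?_ hiter
  have hk := hH.khat_pos (t * 2 ^ n) (by positivity)
  gcongr
  exact le_add_of_nonneg_right (by positivity)

theorem regVary_of_lt_one {H khat : ℝ → ℝ} {γ ρ : ℝ} (hH : AssumptionH H γ ρ khat)
    (hne : ∀ᶠ t in atTop, H t ≠ 0) (hγ : γ < 1) (hneg : ∀ᶠ t in atTop, H t ≤ 0)
    (hlow : ∀ d : ℝ, d < 0 → ∀ᶠ t in atTop, d * t ≤ H t) : RegVary H γ := by
  refine regVary_of_tendsto_div_of_ne_one hH hne hγ.ne ?_
  obtain ⟨w, hw, hrec⟩ := exists_doubling_defect hH hγ.ne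
  obtain ⟨K, hK⟩ := exists_div_pow_two_le hH hγ
  have hr : Tendsto (fun t => khat (t * 2) / khat t / 2) atTop (𝓝 (2 ^ γ / 2)) :=
    (hH.khat_rv 2 two_pos).div_const 2
  have hr1 : (2 : ℝ) ^ γ / 2 < 1 := by
    have := Real.rpow_lt_rpow_of_exponent_lt one_lt_two hγ
    rw [Real.rpow_one] at this
    linarith
  obtain ⟨s, hs1, hs2⟩ := exists_between hr1
  have hs0 : 0 ≤ s := le_trans (by positivity) hs1.le
  refine tendsto_zero_of_backward_contraction (q := s) (B := |K| + |ρ / (γ - 1)|) hs0 hs2 ?_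
    (fun ε hε => ?_)
  · filter_upwards [hK, hneg, eventually_gt_atTop 0] with t hKt hnt ht
    have hk := hH.khat_pos t ht
    have h1 : 0 ≤ (H t + K * khat t) / t := by
      refine le_of_forall_lt fun d hd => ?_
      obtain ⟨d', hd1, hd2⟩ := exists_between hd
      have hseq : Tendsto (fun n : ℕ => t * (2 : ℝ) ^ n) atTop atTop :=
        (tendsto_pow_atTop_atTop_of_one_lt one_lt_two).const_mul_atTop ht
      obtain ⟨n, hn⟩ := (hseq.eventually (hlow d' hd2)).exists
      exact hd1.trans_le (((le_div_iff₀ (by positivity)).2 hn).trans (hKt n))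
    have h2 : 0 ≤ H t + K * khat t := by
      have := mul_nonneg h1 ht.le
      rwa [div_mul_cancel₀ _ ht.ne'] at this
    have h3 : |H t / khat t| ≤ |K| := by
      rw [abs_of_nonpos (div_nonpos_of_nonpos_of_nonneg hnt hk.le), ← neg_div, div_le_iff₀ hk]
      nlinarith [le_abs_self K]
    exact (abs_sub _ _).trans (by gcongr)
  · have hwe : ∀ᶠ t in atTop, |w t| < ε := by
      simpa using (hw.abs).eventually (gt_mem_nhds (by simpa using hε))
    filter_upwards [hwe, hr.eventually (gt_mem_nhds hs1), eventually_gt_atTop 0] with t h1 h2 ht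
    have h3 := hrec t ht
    have hr0 : 0 < khat (t * 2) / khat t / 2 :=
      div_pos (div_pos (hH.khat_pos _ (by linarith)) (hH.khat_pos t ht)) two_pos
    set e2 := H (t * 2) / khat (t * 2) - ρ / (γ - 1)
    set e1 := H t / khat t - ρ / (γ - 1)
    set r := khat (t * 2) / khat t / 2
    have h4 : |e1| ≤ r * |e2| + |w t| := by
      rw [show e1 = e2 * r - w t by linarith]
      refine (abs_sub _ _).trans ?_
      rw [abs_mul, abs_of_pos hr0, mul_comm]
    linarith [mul_le_mul_of_nonneg_right h2.le (abs_nonneg e2)]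

/-- For `γ < 1` the slope `H t / t` stays bounded along doublings. -/
theorem false_of_lt_one_of_superlinear {H khat : ℝ → ℝ} {γ ρ : ℝ} (hH : AssumptionH H γ ρ khat)
    (hγ : γ < 1) (hlow : ∀ d : ℝ, ∀ᶠ t in atTop, d * t ≤ H t) : False := by
  obtain ⟨K, hK⟩ := exists_div_pow_two_le hH hγ
  obtain ⟨t, hKt, ht⟩ := (hK.and (eventually_gt_atTop 0)).exists
  have hseq : Tendsto (fun n : ℕ => t * (2 : ℝ) ^ n) atTop atTop :=
    (tendsto_pow_atTop_atTop_of_one_lt one_lt_two).const_mul_atTop ht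
  obtain ⟨n, hn⟩ := (hseq.eventually (hlow ((H t + K * khat t) / t + 1))).exists
  have h1 := ((le_div_iff₀ (by positivity)).2 hn).trans (hKt n)
  linarith

/-- Under Assumption (H), if `esssup ξ ∈ {0, ∞}` and `H(t) ≠ 0` for all
sufficiently large `t`, then `H` is regularly varying with index `γ`. -/
theorem stmt0 {Ω : Type*} [MeasurableSpace Ω] (P : Measure Ω) [IsProbabilityMeasure P]
    (ξ : Ω → ℝ) (hmeas : Measurable ξ)
    (hint : ∀ t : ℝ, 0 < t → Integrable (fun ω => Real.exp (t * ξ ω)) P)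
    (H : ℝ → ℝ) (hHdef : ∀ t, H t = Real.log (∫ ω, Real.exp (t * ξ ω) ∂P))
    (γ ρ : ℝ) (khat : ℝ → ℝ) (hH : AssumptionH H γ ρ khat)
    (hess : essSup (fun ω => (ξ ω : EReal)) P ∈ ({0, ⊤} : Set EReal))
    (hne : ∀ᶠ t in atTop, H t ≠ 0) :
    RegVary H γ := by
  obtain rfl : H = fun t => Real.log (∫ ω, Real.exp (t * ξ ω) ∂P) := funext hHdef
  rcases hess with h0 | htop
  · have hneg : ∀ᶠ t in atTop, Real.log (∫ ω, Real.exp (t * ξ ω) ∂P) ≤ 0 := by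
      filter_upwards [eventually_gt_atTop 0] with t ht
      exact log_integral_exp_nonpos P hint h0 ht
    rcases lt_trichotomy γ 1 with hγ | rfl | hγ
    · refine regVary_of_lt_one hH hne hγ hneg fun d hd => ?_
      obtain ⟨c, hdc, hc⟩ := exists_between hd
      exact eventually_mul_le_log_integral_exp P hint (by rw [h0]; exact_mod_cast hc) hdc
    · exact regVary_one hH hne (Or.inl hneg)
    · exact regVary_of_one_lt hH hne hγ (continuousOn_log_integral_exp P hint)
  · have hlow : ∀ d : ℝ, ∀ᶠ t in atTop, d * t ≤ Real.log (∫ ω, Real.exp (t * ξ ω) ∂P) :=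
      fun d => eventually_mul_le_log_integral_exp P hint
        (by rw [Set.mem_singleton_iff.1 htop]; exact EReal.coe_lt_top _) (lt_add_one d)
    rcases lt_trichotomy γ 1 with hγ | rfl | hγ
    · exact (false_of_lt_one_of_superlinear hH hγ hlow).elim
    · exact regVary_one hH hne (Or.inr (by simpa using hlow 0))
    · exact regVary_of_one_lt hH hne hγ (continuousOn_log_integral_exp P hint)
end

section
/- Under Assumption (H), if additionally E[ξ] = 0 and ξ is not almost surely equal to 0 (so that H(t) > 0 for all t > 0), then H is regularly varying with index max{γ, 1}, i.e. for every y > 0 one has lim_{t→∞} H(ty)/H(t) = y^{max{γ,1}}. -/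
open MeasureTheory Filter
open scoped ENNReal NNReal Topology

/-- A locally bounded function satisfying an asymptotically contracting recursion under doubling
tends to `0` at infinity. -/
theorem tendsto_zero_of_doubling_contraction {u r e : ℝ → ℝ} {q : ℝ} (hq : |q| < 1)
    (hr : Tendsto r atTop (𝓝 q)) (he : Tendsto e atTop (𝓝 0))
    (hu : ∀ᶠ t in atTop, u (t * 2) = r t * u t + e t)
    (hb : ∀ T : ℝ, 0 < T → ∃ M, ∀ t ∈ Set.Icc T (2 * T), |u t| ≤ M) :
    Tendsto u atTop (𝓝 0) := by
  obtain ⟨p, hqp, hp1⟩ := exists_between hq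
  have hp0 : 0 ≤ p := (abs_nonneg q).trans hqp.le
  rw [Metric.tendsto_atTop]
  intro ε hε
  have hδ : 0 < ε / 2 * (1 - p) := mul_pos (half_pos hε) (sub_pos.2 hp1)
  have hr' : ∀ᶠ t in atTop, |r t| < p := hr.abs.eventually_lt_const hqp
  have he' : ∀ᶠ t in atTop, |e t| < ε / 2 * (1 - p) := by
    refine he.abs.eventually_lt_const ?_
    simpa using hδ
  obtain ⟨T₀, hT₀⟩ := eventually_atTop.1 (hr'.and (he'.and hu))
  obtain ⟨T, hTpos, hT₀T⟩ : ∃ T : ℝ, 0 < T ∧ T₀ ≤ T :=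
    ⟨max T₀ 1, by positivity, le_max_left _ _⟩
  obtain ⟨M, hM⟩ := hb T hTpos
  have hM0 : 0 ≤ M := (abs_nonneg _).trans (hM T ⟨le_rfl, by linarith⟩)
  have iter : ∀ s ∈ Set.Icc T (2 * T), ∀ n : ℕ, |u (s * 2 ^ n)| ≤ p ^ n * M + ε / 2 := by
    intro s hs n
    induction n with
    | zero => simpa using (hM s hs).trans (by linarith)
    | succ n ih =>
      have hsn : T ≤ s * 2 ^ n := by
        nlinarith [hs.1, one_le_pow₀ (n := n) (one_le_two : (1 : ℝ) ≤ 2)]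
      obtain ⟨h1, h2, h3⟩ := hT₀ _ (hT₀T.trans hsn)
      rw [pow_succ, ← mul_assoc, h3]
      calc |r (s * 2 ^ n) * u (s * 2 ^ n) + e (s * 2 ^ n)|
          ≤ |r (s * 2 ^ n)| * |u (s * 2 ^ n)| + |e (s * 2 ^ n)| := by
            rw [← abs_mul]; exact abs_add_le _ _
        _ ≤ p * (p ^ n * M + ε / 2) + ε / 2 * (1 - p) := by gcongr
        _ = p ^ (n + 1) * M + ε / 2 := by ring
  have hpow : Tendsto (fun n : ℕ => p ^ n * M) atTop (𝓝 0) := by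
    simpa using (tendsto_pow_atTop_nhds_zero_of_lt_one hp0 hp1).mul_const M
  obtain ⟨N, hN⟩ := eventually_atTop.1 (hpow.eventually_lt_const (half_pos hε))
  refine ⟨2 ^ N * T, fun t ht => ?_⟩
  have htT : 2 ^ N ≤ t / T := (le_div_iff₀ hTpos).2 ht
  obtain ⟨n, hn1, hn2⟩ := exists_nat_pow_near ((one_le_pow₀ one_le_two).trans htT)
    (one_lt_two : (1 : ℝ) < 2)
  have hNn : N ≤ n := by
    have := (pow_lt_pow_iff_right₀ (one_lt_two : (1 : ℝ) < 2)).1 (htT.trans_lt hn2)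
    omega
  have hmem : t / 2 ^ n ∈ Set.Icc T (2 * T) := by
    rw [le_div_iff₀ hTpos] at hn1
    rw [div_lt_iff₀ hTpos, pow_succ] at hn2
    constructor
    · rw [le_div_iff₀ (by positivity)]; linarith
    · rw [div_le_iff₀ (by positivity)]; linarith
  have hfin := iter _ hmem n
  rw [div_mul_cancel₀ _ (by positivity)] at hfin
  have := hN n hNn
  rw [Real.dist_eq, sub_zero]
  linarith

theorem AssumptionH.tendsto {H : ℝ → ℝ} {γ ρ : ℝ} {khat : ℝ → ℝ}
    (hH : AssumptionH H γ ρ khat) {y : ℝ} (hy : 0 ≤ y) :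
    Tendsto (fun t => (H (t * y) - y * H t) / khat t) atTop (𝓝 (ρ * hatH γ y)) :=
  (hH.conv {y} isCompact_singleton (by simpa using hy)).tendsto_at (Set.mem_singleton y)

theorem tendsto_neg_hatH_div_atTop {γ : ℝ} (hγ : γ ≤ 1) :
    Tendsto (fun y => -hatH γ y / y) (𝓝[>] 0) atTop := by
  rcases hγ.eq_or_lt with rfl | hγ
  · refine (tendsto_neg_atBot_atTop.comp Real.tendsto_log_nhdsGT_zero).congr' ?_
    filter_upwards [self_mem_nhdsWithin] with y hy
    have : y ≠ 0 := ne_of_gt hy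
    simp only [hatH, if_true, Function.comp_apply]
    field_simp
  · have h : Tendsto (fun y : ℝ => (y ^ (γ - 1) - 1) / (1 - γ)) (𝓝[>] 0) atTop := by
      refine Tendsto.atTop_div_const (by linarith) (tendsto_atTop_add_const_right _ (-1) ?_)
      exact tendsto_rpow_neg_nhdsGT_zero (by linarith)
    refine h.congr' ?_
    filter_upwards [self_mem_nhdsWithin] with y hy
    have hy0 : y ≠ 0 := ne_of_gt hy
    have : 1 - γ ≠ 0 := by linarith
    simp only [hatH, hγ.ne, if_false, mpow, hy0, Real.rpow_sub_one hy0]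
    field_simp
    ring

theorem AssumptionH.tendsto_div_khat_atTop {H : ℝ → ℝ} {γ ρ : ℝ} {khat : ℝ → ℝ}
    (hH : AssumptionH H γ ρ khat) (hnonneg : ∀ t, 0 < t → 0 ≤ H t) (hγ : γ ≤ 1) :
    Tendsto (fun t => H t / khat t) atTop atTop := by
  rw [tendsto_atTop]
  intro M
  obtain ⟨y, hyM, hy⟩ := (((tendsto_neg_hatH_div_atTop hγ).eventually_gt_atTop (M / ρ)).and
    self_mem_nhdsWithin).exists
  have hy : 0 < y := hy
  have hlt : ρ * hatH γ y < -(M * y) := by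
    rw [div_lt_div_iff₀ hH.hρ hy] at hyM
    linarith
  filter_upwards [(hH.tendsto hy.le).eventually_lt_const hlt, eventually_gt_atTop 0] with t ht ht0
  have hk := hH.khat_pos t ht0
  rw [div_lt_iff₀ hk] at ht
  rw [le_div_iff₀ hk]
  have := hnonneg (t * y) (by positivity)
  nlinarith

theorem AssumptionH.tendsto_div_khat {H : ℝ → ℝ} {γ ρ : ℝ} {khat : ℝ → ℝ}
    (hH : AssumptionH H γ ρ khat)
    (hb : ∀ T : ℝ, 0 < T → ∃ M, ∀ t ∈ Set.Icc T (2 * T), |H t| ≤ M) (hγ : 1 < γ) :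
    Tendsto (fun t => H t / khat t) atTop (𝓝 (ρ / (γ - 1))) := by
  set l := ρ / (γ - 1) with hl
  have hγ0 : γ - 1 ≠ 0 := by linarith
  have h2γ : (2 : ℝ) < 2 ^ γ := by
    simpa using Real.rpow_lt_rpow_of_exponent_lt (one_lt_two : (1 : ℝ) < 2) hγ
  have hhat : ρ * hatH γ 2 = l * (2 ^ γ - 2) := by
    have : 1 - γ ≠ 0 := by linarith
    simp only [hatH, hγ.ne', if_false, mpow, two_ne_zero, hl]
    field_simp
    ring
  have hrinv : Tendsto (fun t => (khat (t * 2) / khat t)⁻¹) atTop (𝓝 ((2 ^ γ)⁻¹)) :=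
    (hH.khat_rv 2 two_pos).inv₀ (by positivity)
  have hd := hH.tendsto (y := 2) (by norm_num)
  rw [hhat] at hd
  have key : Tendsto (fun t => H t / khat t - l) atTop (𝓝 0) := by
    refine tendsto_zero_of_doubling_contraction
      (r := fun t => (khat (t * 2) / khat t)⁻¹ * 2)
      (e := fun t => (khat (t * 2) / khat t)⁻¹ *
        ((H (t * 2) - 2 * H t) / khat t + 2 * l) - l)
      (q := (2 ^ γ)⁻¹ * 2) ?_ (hrinv.mul_const 2) ?_ ?_ ?_
    · rw [abs_of_pos (by positivity), inv_mul_lt_iff₀ (by positivity)]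
      linarith
    · have := (hrinv.mul (hd.add_const (2 * l))).sub_const l
      convert this using 2
      field_simp
      ring
    · filter_upwards [eventually_gt_atTop 0] with t ht
      have h1 := (hH.khat_pos t ht).ne'
      have h2 := (hH.khat_pos (t * 2) (by positivity)).ne'
      field_simp
      ring
    · intro T hT
      obtain ⟨M, hM⟩ := hb T hT
      have hM0 : 0 ≤ M := (abs_nonneg _).trans (hM T ⟨le_rfl, by linarith⟩)
      have hcont : ContinuousOn (fun t => (khat t)⁻¹) (Set.Icc T (2 * T)) :=
        (hH.khat_cont.mono fun t ht => hT.trans_le ht.1).inv₀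
          fun t ht => (hH.khat_pos t (hT.trans_le ht.1)).ne'
      obtain ⟨C, hC⟩ := isCompact_Icc.exists_bound_of_continuousOn hcont
      refine ⟨M * C + |l|, fun t ht => (abs_sub _ _).trans ?_⟩
      rw [div_eq_mul_inv, abs_mul]
      gcongr
      · exact hM t ht
      · exact hC t ht
  simpa using key.add_const l

theorem AssumptionH.regVary {H : ℝ → ℝ} {γ ρ : ℝ} {khat : ℝ → ℝ}
    (hH : AssumptionH H γ ρ khat) (hnonneg : ∀ t, 0 < t → 0 ≤ H t)
    (hb : ∀ T : ℝ, 0 < T → ∃ M, ∀ t ∈ Set.Icc T (2 * T), |H t| ≤ M) :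
    RegVary H (max γ 1) := by
  intro y hy
  have hd := hH.tendsto hy.le
  have heq : ∀ᶠ t in atTop, 0 < H t / khat t →
      y + (H (t * y) - y * H t) / khat t / (H t / khat t) = H (t * y) / H t := by
    filter_upwards [eventually_gt_atTop 0] with t ht hpos
    have hk := (hH.khat_pos t ht).ne'
    have hHt : H t ≠ 0 := by
      rintro h
      simp [h] at hpos
    field_simp
    ring
  rcases le_or_gt γ 1 with hγ | hγ
  · have hw := hH.tendsto_div_khat_atTop hnonneg hγ
    rw [max_eq_right hγ, Real.rpow_one]
    have := (hd.div_atTop hw).const_add y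
    rw [add_zero] at this
    refine this.congr' ?_
    filter_upwards [heq, hw.eventually_gt_atTop 0] with t h1 h2 using h1 h2
  · have hw := hH.tendsto_div_khat hb hγ
    have hl : 0 < ρ / (γ - 1) := div_pos hH.hρ (by linarith)
    rw [max_eq_left hγ.le]
    have hlim : y + ρ * hatH γ y / (ρ / (γ - 1)) = y ^ γ := by
      have h1 : 1 - γ ≠ 0 := by linarith
      have h2 : γ - 1 ≠ 0 := by linarith
      have h3 := hH.hρ.ne'
      simp only [hatH, hγ.ne', if_false, mpow, hy.ne']
      field_simp
      ring
    rw [← hlim]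
    refine ((hd.div hw hl.ne').const_add y).congr' ?_
    filter_upwards [heq, hw.eventually_const_lt hl] with t h1 h2 using h1 h2

theorem one_le_integral_exp_mul {Ω : Type*} [MeasurableSpace Ω] {P : Measure Ω}
    [IsProbabilityMeasure P] {ξ : Ω → ℝ} (hintξ : Integrable ξ P) (hmean : ∫ ω, ξ ω ∂P = 0)
    {t : ℝ} (hint : Integrable (fun ω => Real.exp (t * ξ ω)) P) :
    1 ≤ ∫ ω, Real.exp (t * ξ ω) ∂P := by
  have h : ∫ ω, (t * ξ ω + 1) ∂P ≤ ∫ ω, Real.exp (t * ξ ω) ∂P :=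
    integral_mono ((hintξ.const_mul t).add (integrable_const 1)) hint
      fun ω => Real.add_one_le_exp _
  rw [integral_add (hintξ.const_mul t) (integrable_const 1), integral_const_mul, hmean] at h
  simpa using h

theorem integral_exp_mul_le_add_one {Ω : Type*} [MeasurableSpace Ω] {P : Measure Ω}
    [IsProbabilityMeasure P] {ξ : Ω → ℝ} {s t : ℝ} (hs : 0 ≤ s) (hst : s ≤ t)
    (hints : Integrable (fun ω => Real.exp (s * ξ ω)) P)
    (hintt : Integrable (fun ω => Real.exp (t * ξ ω)) P) :
    ∫ ω, Real.exp (s * ξ ω) ∂P ≤ ∫ ω, Real.exp (t * ξ ω) ∂P + 1 := by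
  have h : ∫ ω, Real.exp (s * ξ ω) ∂P ≤ ∫ ω, (Real.exp (t * ξ ω) + 1) ∂P := by
    refine integral_mono hints (hintt.add (integrable_const 1)) fun ω => ?_
    rcases le_total 0 (ξ ω) with h | h
    · have := Real.exp_le_exp.2 (mul_le_mul_of_nonneg_right hst h)
      simp only
      linarith
    · have := Real.exp_le_one_iff.2 (mul_nonpos_of_nonneg_of_nonpos hs h)
      simp only
      linarith [Real.exp_pos (t * ξ ω)]
  rw [integral_add hintt (integrable_const 1)] at h
  simpa using h

/-- Under Assumption (H), if `E[ξ] = 0` and `ξ` is not a.s. `0`, then `H` is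
regularly varying with index `max γ 1`. -/
theorem stmt1 {Ω : Type*} [MeasurableSpace Ω] (P : Measure Ω) [IsProbabilityMeasure P]
    (ξ : Ω → ℝ) (hmeas : Measurable ξ) (hintξ : Integrable ξ P)
    (hmean : ∫ ω, ξ ω ∂P = 0) (hne : ¬ ∀ᵐ ω ∂P, ξ ω = 0)
    (hint : ∀ t : ℝ, 0 < t → Integrable (fun ω => Real.exp (t * ξ ω)) P)
    (H : ℝ → ℝ) (hHdef : ∀ t, H t = Real.log (∫ ω, Real.exp (t * ξ ω) ∂P))
    (γ ρ : ℝ) (khat : ℝ → ℝ) (hH : AssumptionH H γ ρ khat) :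
    RegVary H (max γ 1) := by
  have hnonneg : ∀ t, 0 < t → 0 ≤ H t := fun t ht => by
    rw [hHdef]
    exact Real.log_nonneg (one_le_integral_exp_mul hintξ hmean (hint t ht))
  refine hH.regVary hnonneg fun T hT => ?_
  refine ⟨Real.log (∫ ω, Real.exp (2 * T * ξ ω) ∂P + 1), fun t ht => ?_⟩
  have ht0 : 0 < t := hT.trans_le ht.1
  rw [abs_of_nonneg (hnonneg t ht0), hHdef]
  refine Real.log_le_log ?_ ?_
  · exact one_pos.trans_le (one_le_integral_exp_mul hintξ hmean (hint t ht0))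
  · exact integral_exp_mul_le_add_one ht0.le ht.2 (hint t ht0) (hint _ (by positivity))
end

section
/- Let d ≥ 1. For any ρ > 0 and any γ with γ ≠ 1 and 0 ≤ γ < max{1 + 1/d, 1 + ρ/(2d)}, the infimum defining χ^{DB}_γ(ρ) is attained: there exists a probability measure p on ℤ^d such that S(p) + (ρ/(1−γ)) Σ_z (p(z)^γ − p(z)) ≤ S(q) + (ρ/(1−γ)) Σ_z (q(z)^γ − q(z)) for every probability measure q on ℤ^d (both sides taking values in [0,∞]). -/
open MeasureTheory Filter
open scoped ENNReal NNReal Topology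

/-- The local cost `ρ/(1-γ) (t^γ - t)`. -/
noncomputable def dbPot (γ ρ t : ℝ) : ℝ := ρ / (1 - γ) * (mpow t γ - t)

lemma mpow_zero (γ : ℝ) : mpow 0 γ = 0 := by simp [mpow]

lemma mpow_of_pos {t : ℝ} (ht : 0 < t) (γ : ℝ) : mpow t γ = t ^ γ := by simp [mpow, ht.ne']

lemma mpow_nonneg {t : ℝ} (ht : 0 ≤ t) (γ : ℝ) : 0 ≤ mpow t γ := by
  unfold mpow; split_ifs
  · exact le_rfl
  · exact Real.rpow_nonneg ht γ

lemma mpow_mono {s t γ : ℝ} (hγ : 0 ≤ γ) (hs : 0 ≤ s) (hst : s ≤ t) : mpow s γ ≤ mpow t γ := by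
  rcases hs.eq_or_lt with rfl | h
  · rw [mpow_zero]; exact mpow_nonneg hst γ
  · rw [mpow_of_pos h, mpow_of_pos (h.trans_le hst)]
    exact Real.rpow_le_rpow hs hst hγ

lemma mpow_mul {s t : ℝ} (γ : ℝ) (hs : 0 ≤ s) (ht : 0 ≤ t) :
    mpow (s * t) γ = mpow s γ * mpow t γ := by
  rcases hs.eq_or_lt with rfl | hs'
  · simp [mpow_zero]
  rcases ht.eq_or_lt with rfl | ht'
  · simp [mpow_zero]
  rw [mpow_of_pos hs', mpow_of_pos ht', mpow_of_pos (mul_pos hs' ht'), Real.mul_rpow hs ht]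

lemma dbPot_zero (γ ρ : ℝ) : dbPot γ ρ 0 = 0 := by simp [dbPot, mpow_zero]

lemma dbPot_of_pos {γ ρ t : ℝ} (ht : 0 < t) :
    dbPot γ ρ t = t * (ρ / (1 - γ) * (t ^ (γ - 1) - 1)) := by
  rw [dbPot, mpow_of_pos ht, Real.rpow_sub_one ht.ne']
  field_simp

lemma slope_antitone {γ ρ s t : ℝ} (hρ : 0 < ρ) (hγ1 : γ ≠ 1) (hs : 0 < s) (hst : s ≤ t) :
    ρ / (1 - γ) * (t ^ (γ - 1) - 1) ≤ ρ / (1 - γ) * (s ^ (γ - 1) - 1) := by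
  rcases lt_or_gt_of_ne hγ1 with h | h
  · have : 0 < ρ / (1 - γ) := div_pos hρ (by linarith)
    have := Real.rpow_le_rpow_of_nonpos hs hst (by linarith : γ - 1 ≤ 0)
    gcongr
  · have : ρ / (1 - γ) ≤ 0 := div_nonpos_of_nonneg_of_nonpos hρ.le (by linarith)
    have := Real.rpow_le_rpow hs.le hst (by linarith : 0 ≤ γ - 1)
    apply mul_le_mul_of_nonpos_left _ ‹_›
    linarith

lemma slope_nonneg {γ ρ t : ℝ} (hρ : 0 < ρ) (hγ1 : γ ≠ 1) (ht : 0 < t) (ht1 : t ≤ 1) :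
    0 ≤ ρ / (1 - γ) * (t ^ (γ - 1) - 1) := by
  simpa using slope_antitone hρ hγ1 ht ht1

lemma dbPot_nonneg {γ ρ t : ℝ} (hρ : 0 < ρ) (hγ1 : γ ≠ 1) (ht : 0 ≤ t) (ht1 : t ≤ 1) :
    0 ≤ dbPot γ ρ t := by
  rcases ht.eq_or_lt with rfl | h
  · rw [dbPot_zero]
  · rw [dbPot_of_pos h]
    exact mul_nonneg ht (slope_nonneg hρ hγ1 h ht1)

lemma dbPot_pos {γ ρ t : ℝ} (hρ : 0 < ρ) (hγ1 : γ ≠ 1) (ht : 0 < t) (ht1 : t < 1) :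
    0 < dbPot γ ρ t := by
  rw [dbPot_of_pos ht]
  apply mul_pos ht
  rcases lt_or_gt_of_ne hγ1 with h | h
  · apply mul_pos (div_pos hρ (by linarith))
    have := Real.one_lt_rpow_of_pos_of_lt_one_of_neg ht ht1 (by linarith : γ - 1 < 0)
    linarith
  · apply mul_pos_of_neg_of_neg (div_neg_of_pos_of_neg hρ (by linarith))
    have := Real.rpow_lt_one ht.le ht1 (by linarith : 0 < γ - 1)
    linarith

lemma dbPot_continuousAt {γ ρ t : ℝ} (ht : 0 < t) : ContinuousAt (dbPot γ ρ) t := by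
  have h : (fun s : ℝ => ρ / (1 - γ) * (s ^ γ - s)) =ᶠ[𝓝 t] dbPot γ ρ := by
    filter_upwards [lt_mem_nhds ht] with s hs
    rw [dbPot, mpow_of_pos hs]
  refine ContinuousAt.congr ?_ h
  exact continuousAt_const.mul
    ((Real.continuousAt_rpow_const t γ (Or.inl ht.ne')).sub continuousAt_id)

lemma dbPot_mul {γ ρ s t : ℝ} (hs : 0 ≤ s) (ht : 0 ≤ t) :
    dbPot γ ρ (s * t) = s * dbPot γ ρ t + dbPot γ ρ s * mpow t γ := by
  simp only [dbPot, mpow_mul γ hs ht]; ring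

/-- The `2d` unit vectors of `ℤ^d`. -/
def unitVecs (d : ℕ) : Finset (Zd d) :=
  (Finset.univ ×ˢ ({1, -1} : Finset ℤ)).image fun a : Fin d × ℤ => Pi.single a.1 a.2

lemma mem_unitVecs {d : ℕ} {e : Zd d} : e ∈ unitVecs d ↔ ∑ i, |e i| = 1 := by
  constructor
  · intro h
    simp only [unitVecs, Finset.mem_image, Finset.mem_product, Finset.mem_univ, true_and,
      Finset.mem_insert, Finset.mem_singleton, Prod.exists] at h
    obtain ⟨i, s, hs, rfl⟩ := h
    rw [Finset.sum_eq_single i]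
    · rcases hs with rfl | rfl <;> simp
    · intro j _ hj; simp [Pi.single_eq_of_ne hj]
    · simp
  · intro h
    obtain ⟨i, hi⟩ : ∃ i, e i ≠ 0 := by
      by_contra! H
      simp [H] at h
    rw [← Finset.add_sum_erase _ _ (Finset.mem_univ i)] at h
    have h1 : 1 ≤ |e i| := Int.one_le_abs hi
    have h0 : 0 ≤ ∑ j ∈ Finset.univ.erase i, |e j| := Finset.sum_nonneg fun _ _ => abs_nonneg _
    have hz : ∑ j ∈ Finset.univ.erase i, |e j| = 0 := by omega
    rw [Finset.sum_eq_zero_iff_of_nonneg fun _ _ => abs_nonneg _] at hz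
    have hi1 : |e i| = 1 := by omega
    refine Finset.mem_image.2 ⟨(i, e i), ?_, ?_⟩
    · simpa using eq_or_eq_neg_of_abs_eq hi1
    · ext j
      by_cases hj : j = i
      · subst hj; simp
      · have := hz j (by simp [hj])
        simp [Pi.single_eq_of_ne hj, abs_eq_zero.1 this]

lemma card_unitVecs_le (d : ℕ) : (unitVecs d).card ≤ 2 * d := by
  refine Finset.card_image_le.trans ?_
  simp [Finset.card_product, mul_comm]

lemma dirS_eq {d : ℕ} (p : Zd d → ℝ) :
    dirS p = 2⁻¹ * ∑' z : Zd d, ∑ e ∈ unitVecs d,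
      ENNReal.ofReal ((Real.sqrt (p (z + e)) - Real.sqrt (p z)) ^ 2) := by
  unfold dirS
  congr 1
  refine tsum_congr fun z => ?_
  rw [← (Equiv.addLeft z).tsum_eq, tsum_eq_sum (s := unitVecs d)]
  · refine Finset.sum_congr rfl fun e he => ?_
    simp [mem_unitVecs.1 he]
  · intro e he
    rw [mem_unitVecs] at he
    simp [he]

lemma FDB_eq {d : ℕ} (γ ρ : ℝ) (p : Zd d → ℝ) :
    FDB γ ρ p = dirS p + ∑' z, ENNReal.ofReal (dbPot γ ρ (p z)) := rfl

lemma FDB_translate {d : ℕ} (γ ρ : ℝ) (p : Zd d → ℝ) (w : Zd d) :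
    FDB γ ρ (fun z => p (z + w)) = FDB γ ρ p := by
  rw [FDB_eq, FDB_eq, dirS_eq, dirS_eq]
  congr 1
  · congr 1
    refine Eq.trans ?_ ((Equiv.addRight w).tsum_eq _)
    simp [add_right_comm]
  · exact (Equiv.addRight w).tsum_eq fun z => ENNReal.ofReal (dbPot γ ρ (p z))

lemma IsProb.translate {d : ℕ} {p : Zd d → ℝ} (hp : IsProb p) (w : Zd d) :
    IsProb fun z => p (z + w) :=
  ⟨fun _ => hp.1 _, (Equiv.addRight w).hasSum_iff.2 hp.2⟩

lemma IsProb.le_one {d : ℕ} {p : Zd d → ℝ} (hp : IsProb p) (z : Zd d) : p z ≤ 1 :=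
  le_hasSum hp.2 z fun _ _ => hp.1 _

lemma dirS_mul {d : ℕ} {s : ℝ} (hs : 0 ≤ s) (p : Zd d → ℝ) :
    dirS (fun z => s * p z) = ENNReal.ofReal s * dirS p := by
  rw [dirS_eq, dirS_eq, mul_left_comm]
  congr 1
  rw [← ENNReal.tsum_mul_left]
  refine tsum_congr fun z => ?_
  rw [Finset.mul_sum]
  refine Finset.sum_congr rfl fun e _ => ?_
  rw [← ENNReal.ofReal_mul hs, Real.sqrt_mul hs, Real.sqrt_mul hs, ← mul_sub, mul_pow,
    Real.sq_sqrt hs]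

lemma chiDB_le {d : ℕ} {γ ρ : ℝ} {q : Zd d → ℝ} (hq : IsProb q) : chiDB d γ ρ ≤ FDB γ ρ q :=
  iInf_le (fun p : {p : Zd d → ℝ // IsProb p} => FDB γ ρ p.1) ⟨q, hq⟩

/-- Strict superlinearity in the mass of the constrained infimum. -/
lemma le_FDB_of_hasSum {d : ℕ} {γ ρ μ : ℝ} (hρ : 0 < ρ) (hγ0 : 0 ≤ γ) (hγ1 : γ ≠ 1)
    {q : Zd d → ℝ} (hq0 : ∀ z, 0 ≤ q z) (hq : HasSum q μ) (hμ : μ ≤ 1) :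
    ENNReal.ofReal μ * chiDB d γ ρ +
      ENNReal.ofReal (dbPot γ ρ μ) * ENNReal.ofReal (mpow (q 0) γ) ≤ FDB γ ρ q := by
  have hμ0 : 0 ≤ μ := hq.nonneg hq0
  rcases hμ0.eq_or_lt with rfl | hpos
  · simp [dbPot_zero]
  set r : Zd d → ℝ := fun z => q z / μ with hr
  have hrp : IsProb r := by
    refine ⟨fun z => div_nonneg (hq0 z) hμ0, ?_⟩
    have := hq.div_const μ
    rwa [div_self hpos.ne'] at this
  have hqr : q = fun z => μ * r z := by
    ext z; simp only [hr]; field_simp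
  have h0 : q 0 ≤ r 0 := by
    simp only [hr]; rw [le_div_iff₀ hpos]; nlinarith [hq0 0]
  have key : FDB γ ρ q = ENNReal.ofReal μ * FDB γ ρ r +
      ENNReal.ofReal (dbPot γ ρ μ) * ∑' z, ENNReal.ofReal (mpow (r z) γ) := by
    rw [FDB_eq, FDB_eq, hqr, dirS_mul hμ0, mul_add, add_assoc, ← ENNReal.tsum_mul_left,
      ← ENNReal.tsum_mul_left, ← ENNReal.tsum_add]
    congr 1
    refine tsum_congr fun z => ?_
    have h1 := dbPot_nonneg hρ hγ1 (hrp.1 z) (hrp.le_one z)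
    have h2 := dbPot_nonneg hρ hγ1 hμ0 hμ
    have h3 := mpow_nonneg (hrp.1 z) γ
    rw [dbPot_mul hμ0 (hrp.1 z), ENNReal.ofReal_add (by positivity) (by positivity),
      ENNReal.ofReal_mul hμ0, ENNReal.ofReal_mul h2]
  rw [key]
  gcongr
  · exact chiDB_le hrp
  · exact (ENNReal.ofReal_le_ofReal (mpow_mono hγ0 (hq0 0) h0)).trans
      (ENNReal.le_tsum (f := fun z => ENNReal.ofReal (mpow (r z) γ)) 0)

/-- If all atoms are small then the energy is large. -/
lemma le_FDB_of_le {d : ℕ} {γ ρ s : ℝ} (hρ : 0 < ρ) (hγ1 : γ ≠ 1) (hs : 0 < s) (hs1 : s ≤ 1)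
    {p : Zd d → ℝ} (hp : IsProb p) (h : ∀ z, p z ≤ s) :
    ENNReal.ofReal (ρ / (1 - γ) * (s ^ (γ - 1) - 1)) ≤ FDB γ ρ p := by
  have h1 : ∑' z, ENNReal.ofReal (p z) = 1 := by
    rw [← ENNReal.ofReal_tsum_of_nonneg hp.1 hp.2.summable, hp.2.tsum_eq, ENNReal.ofReal_one]
  have hsn := slope_nonneg hρ hγ1 hs hs1
  calc _ = ∑' z, ENNReal.ofReal (ρ / (1 - γ) * (s ^ (γ - 1) - 1)) * ENNReal.ofReal (p z) := by
        rw [ENNReal.tsum_mul_left, h1, mul_one]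
    _ ≤ ∑' z, ENNReal.ofReal (dbPot γ ρ (p z)) := by
        refine ENNReal.tsum_le_tsum fun z => ?_
        rw [← ENNReal.ofReal_mul hsn]
        apply ENNReal.ofReal_le_ofReal
        rcases (hp.1 z).eq_or_lt with h0 | h0
        · rw [← h0, dbPot_zero, mul_zero]
        · rw [dbPot_of_pos h0, mul_comm]
          exact mul_le_mul_of_nonneg_left (slope_antitone hρ hγ1 h0 (h z)) h0.le
    _ ≤ _ := le_add_self

/-- The interaction between a finite set and its complement, which bounds the error made in
splitting the Dirichlet form. -/
noncomputable def crossErr {d : ℕ} (B : Finset (Zd d)) (p : Zd d → ℝ) : ℝ≥0∞ :=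
  2⁻¹ * ∑' z, ∑ e ∈ unitVecs d,
    if (z ∈ B ↔ z + e ∈ B) then 0 else ENNReal.ofReal (p z + p (z + e))

lemma FDB_split {d : ℕ} (γ ρ : ℝ) (B : Finset (Zd d)) {p : Zd d → ℝ} (hp : ∀ z, 0 ≤ p z) :
    FDB γ ρ ((B : Set (Zd d)).indicator p) + FDB γ ρ ((B : Set (Zd d))ᶜ.indicator p) ≤
      FDB γ ρ p + crossErr B p := by
  have hS : dirS ((B : Set (Zd d)).indicator p) + dirS ((B : Set (Zd d))ᶜ.indicator p) ≤
      dirS p + crossErr B p := by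
    rw [dirS_eq, dirS_eq, dirS_eq, crossErr, ← mul_add, ← mul_add, ← ENNReal.tsum_add,
      ← ENNReal.tsum_add]
    refine mul_le_mul_right (ENNReal.tsum_le_tsum fun z => ?_) _
    rw [← Finset.sum_add_distrib, ← Finset.sum_add_distrib]
    refine Finset.sum_le_sum fun e _ => ?_
    by_cases h1 : z ∈ B <;> by_cases h2 : z + e ∈ B <;> simp only [Set.indicator, Set.mem_compl_iff,
      Finset.mem_coe, h1, h2, not_true_eq_false, not_false_eq_true, if_true, if_false, iff_true,
      iff_false, Real.sqrt_zero, sub_self, sub_zero, zero_sub, neg_sq, Real.sq_sqrt (hp _)]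
    · simp
    · rw [← ENNReal.ofReal_add (hp _) (hp _), add_comm (p z)]
      exact le_add_self
    · rw [← ENNReal.ofReal_add (hp _) (hp _), add_comm (p z)]
      exact le_add_self
    · simp
  have hP : ∑' z, ENNReal.ofReal (dbPot γ ρ ((B : Set (Zd d)).indicator p z)) +
      ∑' z, ENNReal.ofReal (dbPot γ ρ ((B : Set (Zd d))ᶜ.indicator p z)) =
      ∑' z, ENNReal.ofReal (dbPot γ ρ (p z)) := by
    rw [← ENNReal.tsum_add]
    refine tsum_congr fun z => ?_
    by_cases h : z ∈ B <;> simp [h, dbPot_zero]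
  rw [FDB_eq, FDB_eq, FDB_eq, add_add_add_comm, hP, add_right_comm (dirS p)]
  exact add_le_add_left hS _

lemma tendsto_crossErr {d : ℕ} (B : Finset (Zd d)) {ι : Type*} {l : Filter ι}
    {P : ι → Zd d → ℝ} {p : Zd d → ℝ} (h : Tendsto P l (𝓝 p)) :
    Tendsto (fun n => crossErr B (P n)) l (𝓝 (crossErr B p)) := by
  classical
  set A : Finset (Zd d) := B ∪ (unitVecs d).biUnion fun e => B.image fun z => z - e with hA
  have hfin : ∀ q : Zd d → ℝ, crossErr B q = 2⁻¹ * ∑ z ∈ A, ∑ e ∈ unitVecs d,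
      if (z ∈ B ↔ z + e ∈ B) then 0 else ENNReal.ofReal (q z + q (z + e)) := by
    intro q
    rw [crossErr, tsum_eq_sum]
    intro z hz
    refine Finset.sum_eq_zero fun e he => ?_
    have h1 : z ∉ B := fun h => hz (Finset.mem_union_left _ h)
    have h2 : z + e ∉ B := fun h => hz (Finset.mem_union_right _
      (Finset.mem_biUnion.2 ⟨e, he, Finset.mem_image.2 ⟨z + e, h, add_sub_cancel_right _ _⟩⟩))
    simp [h1, h2]
  simp only [hfin]
  rw [tendsto_pi_nhds] at h
  refine ENNReal.Tendsto.const_mul (tendsto_finsetSum _ fun z _ => tendsto_finsetSum _ fun e _ => ?_)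
    (Or.inr (by simp))
  split_ifs
  · exact tendsto_const_nhds
  · exact ENNReal.tendsto_ofReal ((h z).add (h (z + e)))

lemma tendsto_crossErr_atTop {d : ℕ} {p : Zd d → ℝ} (hs : Summable p) :
    Tendsto (fun B => crossErr B p) atTop (𝓝 0) := by
  classical
  set G : Zd d → ℝ≥0∞ := fun z => ∑ e ∈ unitVecs d, ENNReal.ofReal (p z + p (z + e)) with hG
  have hGfin : ∑' z, G z ≠ ∞ := by
    rw [Summable.tsum_finsetSum fun _ _ => ENNReal.summable]
    refine (ENNReal.sum_lt_top.2 fun e _ => ?_).ne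
    exact (hs.add ((Equiv.addRight e).summable_iff.2 hs)).tsum_ofReal_ne_top.lt_top
  rw [ENNReal.tendsto_nhds_zero]
  intro ε hε
  obtain ⟨A, hA⟩ := ((ENNReal.tendsto_nhds_zero.1
    (ENNReal.tendsto_tsum_compl_atTop_zero hGfin)) ε hε).exists
  filter_upwards [eventually_ge_atTop
    (A ∪ (unitVecs d).biUnion fun e => A.image fun z => z + e)] with B hB
  have hmem : ∀ z ∈ A, z ∈ B := fun z hz => hB (Finset.mem_union_left _ hz)
  have hmem' : ∀ z ∈ A, ∀ e ∈ unitVecs d, z + e ∈ B := fun z hz e he =>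
    hB (Finset.mem_union_right _ (Finset.mem_biUnion.2 ⟨e, he, Finset.mem_image_of_mem _ hz⟩))
  calc crossErr B p ≤ 1 * ∑' z, (A : Set (Zd d))ᶜ.indicator G z := by
        unfold crossErr
        gcongr with z
        · simp
        by_cases hz : z ∈ A
        · simp only [Set.indicator, Set.mem_compl_iff, Finset.mem_coe, hz, not_true_eq_false,
            if_false, nonpos_iff_eq_zero]
          refine Finset.sum_eq_zero fun e he => ?_
          simp [hmem z hz, hmem' z hz e he]
        · simp only [Set.indicator, Set.mem_compl_iff, Finset.mem_coe, hz, not_false_eq_true,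
            if_true, hG]
          gcongr with e
          split_ifs
          · exact zero_le
          · exact le_rfl
    _ = ∑' z : {x // x ∉ A}, G z := by
        rw [one_mul]
        exact (tsum_subtype (A : Set (Zd d))ᶜ G).symm
    _ ≤ ε := hA

lemma lowerSemicontinuousAt_FDB {d : ℕ} {γ ρ : ℝ} {p : Zd d → ℝ} (hp : ∀ z, 0 ≤ p z) :
    LowerSemicontinuousAt (FDB (d := d) γ ρ) p := by
  have h1 : LowerSemicontinuousAt (fun q : Zd d → ℝ => ∑' z, 2⁻¹ * ∑ e ∈ unitVecs d,
      ENNReal.ofReal ((Real.sqrt (q (z + e)) - Real.sqrt (q z)) ^ 2)) p := by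
    refine lowerSemicontinuousAt_tsum fun z => Continuous.lowerSemicontinuous ?_ p
    refine ENNReal.continuous_const_mul (by simp) |>.comp ?_
    refine continuous_finsetSum _ fun e _ => ENNReal.continuous_ofReal.comp ?_
    fun_prop
  have h2 : LowerSemicontinuousAt
      (fun q : Zd d → ℝ => ∑' z, ENNReal.ofReal (dbPot γ ρ (q z))) p := by
    refine lowerSemicontinuousAt_tsum fun z => ?_
    rcases (hp z).eq_or_lt with h | h
    · intro y hy
      simp [← h, dbPot_zero] at hy
    · refine ContinuousAt.lowerSemicontinuousAt ?_
      exact ENNReal.continuous_ofReal.continuousAt.comp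
        (ContinuousAt.comp (f := fun q : Zd d → ℝ => q z) (dbPot_continuousAt h)
          (continuous_apply z).continuousAt)
  have h3 := h1.add h2
  have h4 : FDB (d := d) γ ρ = fun q => ∑' z, 2⁻¹ * ∑ e ∈ unitVecs d,
      ENNReal.ofReal ((Real.sqrt (q (z + e)) - Real.sqrt (q z)) ^ 2) +
        ∑' z, ENNReal.ofReal (dbPot γ ρ (q z)) := by
    ext q
    rw [FDB_eq, dirS_eq, ENNReal.tsum_mul_left]
  rwa [h4]

lemma le_crossErr {d : ℕ} {γ ρ s : ℝ} (hρ : 0 < ρ) (hγ0 : 0 ≤ γ) (hγ1 : γ ≠ 1) (hs : 0 ≤ s)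
    (hI : chiDB d γ ρ ≠ ∞) {p : Zd d → ℝ} (hp : IsProb p) (hps : s ≤ p 0) {ε : ℝ≥0∞}
    (hε : FDB γ ρ p ≤ chiDB d γ ρ + ε) {B : Finset (Zd d)} (hB : 0 ∈ B) :
    ENNReal.ofReal (dbPot γ ρ (∑ z ∈ B, p z)) * ENNReal.ofReal (mpow s γ) ≤ ε + crossErr B p := by
  have hsum : HasSum ((B : Set (Zd d)).indicator p) (∑ z ∈ B, p z) := by
    rw [← hasSum_subtype_iff_indicator]
    exact B.hasSum p
  have hsum' : HasSum ((B : Set (Zd d))ᶜ.indicator p) (1 - ∑ z ∈ B, p z) := by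
    rw [Set.indicator_compl]
    exact hp.2.sub hsum
  have hμ0 : 0 ≤ ∑ z ∈ B, p z := Finset.sum_nonneg fun z _ => hp.1 z
  have hμ1 : ∑ z ∈ B, p z ≤ 1 := sum_le_hasSum B (fun z _ => hp.1 z) hp.2
  have hA := le_FDB_of_hasSum hρ hγ0 hγ1 (Set.indicator_nonneg fun z _ => hp.1 z) hsum hμ1
  have hC := le_FDB_of_hasSum hρ hγ0 hγ1 (Set.indicator_nonneg fun z _ => hp.1 z) hsum'
    (by linarith)
  rw [Set.indicator_of_mem (by exact_mod_cast hB)] at hA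
  have hI' : ENNReal.ofReal (∑ z ∈ B, p z) * chiDB d γ ρ +
      ENNReal.ofReal (1 - ∑ z ∈ B, p z) * chiDB d γ ρ = chiDB d γ ρ := by
    rw [← add_mul, ← ENNReal.ofReal_add hμ0 (by linarith)]
    simp
  refine (ENNReal.add_le_add_iff_left hI).1 ?_
  calc chiDB d γ ρ + ENNReal.ofReal (dbPot γ ρ (∑ z ∈ B, p z)) * ENNReal.ofReal (mpow s γ)
      ≤ chiDB d γ ρ + ENNReal.ofReal (dbPot γ ρ (∑ z ∈ B, p z)) * ENNReal.ofReal (mpow (p 0) γ) := by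
        gcongr
        exact mpow_mono hγ0 hs hps
    _ = (ENNReal.ofReal (∑ z ∈ B, p z) * chiDB d γ ρ +
          ENNReal.ofReal (dbPot γ ρ (∑ z ∈ B, p z)) * ENNReal.ofReal (mpow (p 0) γ)) +
        ENNReal.ofReal (1 - ∑ z ∈ B, p z) * chiDB d γ ρ := by
        rw [add_right_comm, hI']
    _ ≤ FDB γ ρ ((B : Set (Zd d)).indicator p) + FDB γ ρ ((B : Set (Zd d))ᶜ.indicator p) :=
        add_le_add hA (le_self_add.trans hC)
    _ ≤ FDB γ ρ p + crossErr B p := FDB_split γ ρ B hp.1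
    _ ≤ chiDB d γ ρ + (ε + crossErr B p) := by
        rw [← add_assoc]; gcongr

lemma exists_isProb_FDB_le_chiDB {d : ℕ} {γ ρ s : ℝ} (hρ : 0 < ρ) (hγ0 : 0 ≤ γ) (hγ1 : γ ≠ 1)
    (hs : 0 < s) (hs1 : s ≤ 1)
    (hI : chiDB d γ ρ < ENNReal.ofReal (ρ / (1 - γ) * (s ^ (γ - 1) - 1))) :
    ∃ p : Zd d → ℝ, IsProb p ∧ FDB γ ρ p ≤ chiDB d γ ρ := by
  have hItop : chiDB d γ ρ ≠ ∞ := hI.ne_top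
  have hex : ∀ n : ℕ, ∃ p : Zd d → ℝ, IsProb p ∧ s ≤ p 0 ∧
      FDB γ ρ p ≤ chiDB d γ ρ + ((n : ℝ≥0∞))⁻¹ := by
    intro n
    have : chiDB d γ ρ < min (chiDB d γ ρ + ((n : ℝ≥0∞))⁻¹)
        (ENNReal.ofReal (ρ / (1 - γ) * (s ^ (γ - 1) - 1))) :=
      lt_min (ENNReal.lt_add_right hItop (by simp)) hI
    obtain ⟨⟨p, hp⟩, hlt⟩ := iInf_lt_iff.1 this
    obtain ⟨w, hw⟩ : ∃ w, s < p w := by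
      by_contra! H
      exact (le_FDB_of_le hρ hγ1 hs hs1 hp H).not_gt (hlt.trans_le (min_le_right _ _))
    refine ⟨fun z => p (z + w), hp.translate w, by simpa using hw.le, ?_⟩
    rw [FDB_translate]
    exact (hlt.trans_le (min_le_left _ _)).le
  choose P hP hPs hPF using hex
  obtain ⟨p, hpmem, φ, hφ, hlim⟩ :=
    (isCompact_univ_pi fun _ : Zd d => isCompact_Icc (a := (0 : ℝ)) (b := 1)).tendsto_subseq
      (x := P) fun n z _ => ⟨(hP n).1 z, (hP n).le_one z⟩
  have hp0 : ∀ z, 0 ≤ p z := fun z => (hpmem z trivial).1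
  have hlim' := tendsto_pi_nhds.1 hlim
  have hps : s ≤ p 0 := ge_of_tendsto' (hlim' 0) fun n => hPs _
  have hle : ∀ B : Finset (Zd d), ∑ z ∈ B, p z ≤ 1 := fun B =>
    le_of_tendsto' (tendsto_finsetSum B fun z _ => hlim' z) fun n =>
      sum_le_hasSum B (fun z _ => (hP _).1 z) (hP _).2
  have hsum : Summable p := summable_of_sum_le hp0 hle
  have hε : Tendsto (fun n => ((φ n : ℕ) : ℝ≥0∞)⁻¹) atTop (𝓝 0) :=
    ENNReal.tendsto_inv_nat_nhds_zero.comp hφ.tendsto_atTop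
  have hcross : ∀ B : Finset (Zd d), 0 ∈ B →
      ENNReal.ofReal (dbPot γ ρ (∑ z ∈ B, p z)) * ENNReal.ofReal (mpow s γ) ≤ crossErr B p := by
    intro B hB
    have hpos : 0 < ∑ z ∈ B, p z :=
      (hs.trans_le hps).trans_le (Finset.single_le_sum (fun z _ => hp0 z) hB)
    have hL : Tendsto (fun n => ENNReal.ofReal (dbPot γ ρ (∑ z ∈ B, P (φ n) z)) *
        ENNReal.ofReal (mpow s γ)) atTop
        (𝓝 (ENNReal.ofReal (dbPot γ ρ (∑ z ∈ B, p z)) * ENNReal.ofReal (mpow s γ))) :=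
      ENNReal.Tendsto.mul_const (ENNReal.tendsto_ofReal ((dbPot_continuousAt hpos).tendsto.comp
        (tendsto_finsetSum B fun z _ => hlim' z))) (Or.inr ENNReal.ofReal_ne_top)
    have hR := hε.add (tendsto_crossErr B hlim)
    rw [zero_add] at hR
    exact le_of_tendsto_of_tendsto' hL hR fun n =>
      le_crossErr hρ hγ0 hγ1 hs.le hItop (hP _) (hPs _) (hPF _) hB
  have hm0 : 0 < ∑' z, p z := (hs.trans_le hps).trans_le (hsum.le_tsum 0 fun z _ => hp0 z)
  have hm1 : ∑' z, p z ≤ 1 := hsum.tsum_le_of_sum_le hle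
  have hm : ∑' z, p z = 1 := by
    by_contra hne
    have hL : Tendsto (fun B : Finset (Zd d) => ENNReal.ofReal (dbPot γ ρ (∑ z ∈ B, p z)) *
        ENNReal.ofReal (mpow s γ)) atTop
        (𝓝 (ENNReal.ofReal (dbPot γ ρ (∑' z, p z)) * ENNReal.ofReal (mpow s γ))) :=
      ENNReal.Tendsto.mul_const (ENNReal.tendsto_ofReal ((dbPot_continuousAt hm0).tendsto.comp
        hsum.hasSum)) (Or.inr ENNReal.ofReal_ne_top)
    have h0 := le_of_tendsto_of_tendsto hL (tendsto_crossErr_atTop hsum) (by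
      filter_upwards [eventually_ge_atTop {0}] with B hB
      exact hcross B (hB (Finset.mem_singleton_self 0)))
    have h1 := dbPot_pos hρ hγ1 hm0 (lt_of_le_of_ne hm1 hne)
    have h2 : 0 < mpow s γ := by rw [mpow_of_pos hs]; positivity
    exact h0.not_gt (ENNReal.mul_pos (ENNReal.ofReal_pos.2 h1).ne' (ENNReal.ofReal_pos.2 h2).ne')
  refine ⟨p, ⟨hp0, hm ▸ hsum.hasSum⟩, le_of_forall_lt_imp_le_of_dense fun y hy => ?_⟩
  have hev := hlim.eventually (lowerSemicontinuousAt_FDB hp0 y hy)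
  have hI := hε.const_add (chiDB d γ ρ)
  rw [add_zero] at hI
  exact ge_of_tendsto hI (hev.mono fun n hn => hn.le.trans (hPF _))

/-- The box `{0, …, R - 1}^d`. -/
noncomputable def latticeBox (d R : ℕ) : Finset (Zd d) :=
  Fintype.piFinset fun _ => Finset.Ico 0 (R : ℤ)

lemma mul_card_boundary_le {d R : ℕ} {e : Zd d} (he : e ∈ unitVecs d) :
    R * ((latticeBox d R).filter fun z => z + e ∉ latticeBox d R).card ≤ R ^ d := by
  simp only [unitVecs, Finset.mem_image, Finset.mem_product, Finset.mem_univ, true_and,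
    Finset.mem_insert, Finset.mem_singleton, Prod.exists] at he
  obtain ⟨i, s, hs, rfl⟩ := he
  set face : Finset (Zd d) := Fintype.piFinset
    (Function.update (fun _ => Finset.Ico 0 (R : ℤ)) i {if s = 1 then (R : ℤ) - 1 else 0}) with hf
  have hsub : ((latticeBox d R).filter fun z => z + Pi.single i s ∉ latticeBox d R) ⊆ face := by
    intro z hz
    simp only [latticeBox, Finset.mem_filter, Fintype.mem_piFinset, Finset.mem_Ico, not_forall]
      at hz
    obtain ⟨hz, j, hj⟩ := hz
    have hji : j = i := by
      by_contra hne
      exact hj (by simpa [Pi.single_eq_of_ne hne] using hz j)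
    subst hji
    rw [hf, Fintype.mem_piFinset]
    intro k
    by_cases hk : k = j
    · subst hk
      have := hz k
      simp only [Pi.add_apply, Pi.single_eq_same] at hj
      rw [Function.update_self, Finset.mem_singleton]
      rcases hs with rfl | rfl
      · simp; omega
      · simp; omega
    · rw [Function.update_of_ne hk]
      exact Finset.mem_Ico.2 (hz k)
  have hcard : R * face.card = R ^ d := by
    rw [hf, Fintype.card_piFinset, ← Finset.mul_prod_erase _ _ (Finset.mem_univ i)]
    rw [Finset.prod_congr rfl (g := fun _ => R) fun k hk => by
      rw [Function.update_of_ne (Finset.ne_of_mem_erase hk)]; simp]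
    have hd : 1 ≤ d := Nat.one_le_iff_ne_zero.2 fun h => by subst h; exact i.elim0
    rw [Function.update_self, Finset.card_singleton, one_mul, Finset.prod_const,
      Finset.card_erase_of_mem (Finset.mem_univ i), Finset.card_univ, Fintype.card_fin,
      mul_comm, ← pow_succ, Nat.sub_add_cancel hd]
  calc _ ≤ R * face.card := Nat.mul_le_mul_left _ (Finset.card_le_card hsub)
    _ = _ := hcard

lemma neg_mem_unitVecs {d : ℕ} {e : Zd d} (he : e ∈ unitVecs d) : -e ∈ unitVecs d := by
  rw [mem_unitVecs] at he ⊢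
  simpa using he

lemma tsum_boundary_le {d R : ℕ} (hR : 1 ≤ R) {e : Zd d} (he : e ∈ unitVecs d) :
    ∑' z : Zd d, (if z ∈ latticeBox d R ∧ z + e ∉ latticeBox d R then
      ENNReal.ofReal ((R : ℝ) ^ d)⁻¹ else 0) ≤ ENNReal.ofReal (R : ℝ)⁻¹ := by
  have hR0 : (0 : ℝ) < R := by exact_mod_cast hR
  rw [tsum_eq_sum (s := (latticeBox d R).filter fun z => z + e ∉ latticeBox d R) (by
    intro z hz
    rw [Finset.mem_filter] at hz
    simp [hz]), Finset.sum_congr rfl (g := fun _ => ENNReal.ofReal ((R : ℝ) ^ d)⁻¹) (by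
    intro z hz
    rw [Finset.mem_filter] at hz
    simp [hz]), Finset.sum_const, nsmul_eq_mul, ← ENNReal.ofReal_natCast,
    ← ENNReal.ofReal_mul (by positivity)]
  apply ENNReal.ofReal_le_ofReal
  have h : (R : ℝ) * (((latticeBox d R).filter fun z => z + e ∉ latticeBox d R).card : ℝ)
      ≤ (R : ℝ) ^ d := by exact_mod_cast mul_card_boundary_le he
  rw [← div_eq_mul_inv, div_le_iff₀ (by positivity), inv_mul_eq_div, le_div_iff₀ hR0]
  linarith

/-- The energy of the uniform distribution on a box. -/
lemma exists_isProb_FDB_le {d R : ℕ} (hR : 1 ≤ R) {γ ρ : ℝ} (hρ : 0 < ρ) (hγ1 : γ ≠ 1) :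
    ∃ q : Zd d → ℝ, IsProb q ∧ FDB γ ρ q ≤ ENNReal.ofReal
      (2 * d / R + ρ / (1 - γ) * ((((R : ℝ) ^ d)⁻¹) ^ (γ - 1) - 1)) := by
  have hR0 : (0 : ℝ) < R := by exact_mod_cast hR
  have hN0 : (0 : ℝ) < ((R : ℝ) ^ d)⁻¹ := by positivity
  have hN1 : ((R : ℝ) ^ d)⁻¹ ≤ 1 := inv_le_one_of_one_le₀ (one_le_pow₀ (by exact_mod_cast hR))
  have hcard : ((latticeBox d R).card : ℝ) = (R : ℝ) ^ d := by
    simp [latticeBox, Fintype.card_piFinset]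
  have hslope := slope_nonneg hρ hγ1 hN0 hN1
  set q : Zd d → ℝ := fun z => if z ∈ latticeBox d R then ((R : ℝ) ^ d)⁻¹ else 0 with hq
  refine ⟨q, ⟨fun z => ?_, ?_⟩, ?_⟩
  · simp only [hq]; split_ifs <;> positivity
  · have h := hasSum_sum_of_ne_finset_zero (L := .unconditional _) (f := q) (s := latticeBox d R)
      fun z hz => by simp [hq, hz]
    rw [Finset.sum_congr rfl (g := fun _ => ((R : ℝ) ^ d)⁻¹) fun z hz => by simp [hq, hz],
      Finset.sum_const, nsmul_eq_mul, hcard, mul_inv_cancel₀ (by positivity)] at h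
    exact h
  rw [FDB_eq, ENNReal.ofReal_add (by positivity) hslope]
  refine add_le_add ?_ (le_of_eq ?_)
  · rw [dirS_eq, Summable.tsum_finsetSum fun _ _ => ENNReal.summable]
    have hterm : ∀ e ∈ unitVecs d, ∑' z, ENNReal.ofReal
        ((Real.sqrt (q (z + e)) - Real.sqrt (q z)) ^ 2) ≤ 2 * ENNReal.ofReal (R : ℝ)⁻¹ := by
      intro e he
      have h2 := tsum_boundary_le hR (neg_mem_unitVecs he)
      rw [← (Equiv.addRight e).tsum_eq] at h2
      rw [two_mul]
      refine le_trans (le_of_eq ?_) (add_le_add (tsum_boundary_le hR he) h2)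
      rw [← ENNReal.tsum_add]
      refine tsum_congr fun z => ?_
      by_cases h1 : z ∈ latticeBox d R <;> by_cases h2 : z + e ∈ latticeBox d R <;>
        simp [hq, h1, h2]
    calc _ ≤ 2⁻¹ * ∑ e ∈ unitVecs d, 2 * ENNReal.ofReal (R : ℝ)⁻¹ :=
          mul_le_mul_right (Finset.sum_le_sum hterm) _
      _ = (unitVecs d).card * ENNReal.ofReal (R : ℝ)⁻¹ := by
          rw [← Finset.mul_sum, ← mul_assoc, ENNReal.inv_mul_cancel (by simp) (by simp), one_mul,
            Finset.sum_const, nsmul_eq_mul]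
      _ ≤ (2 * d : ℕ) * ENNReal.ofReal (R : ℝ)⁻¹ := by
          gcongr
          exact card_unitVecs_le d
      _ = _ := by
          rw [← ENNReal.ofReal_natCast, ← ENNReal.ofReal_mul (by positivity), div_eq_mul_inv]
          push_cast
          rfl
  · rw [tsum_eq_sum (s := latticeBox d R) fun z hz => by simp [hq, hz, dbPot_zero],
      Finset.sum_congr rfl (g := fun _ => ENNReal.ofReal (dbPot γ ρ ((R : ℝ) ^ d)⁻¹))
        fun z hz => by simp [hq, hz],
      Finset.sum_const, nsmul_eq_mul, ← ENNReal.ofReal_natCast,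
      ← ENNReal.ofReal_mul (by positivity), hcard, dbPot_of_pos hN0, ← mul_assoc,
      mul_inv_cancel₀ (by positivity), one_mul]

lemma exists_chiDB_lt {d : ℕ} (hd : 1 ≤ d) {ρ γ : ℝ} (hρ : 0 < ρ) (hγ1 : γ ≠ 1)
    (hγ : γ < max (1 + 1 / (d:ℝ)) (1 + ρ / (2 * d))) :
    ∃ s : ℝ, 0 < s ∧ s ≤ 1 ∧
      chiDB d γ ρ < ENNReal.ofReal (ρ / (1 - γ) * (s ^ (γ - 1) - 1)) := by
  have hd0 : (0 : ℝ) < d := by exact_mod_cast hd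
  suffices H : ∃ (R : ℕ) (s : ℝ), 1 ≤ R ∧ 0 < s ∧ s ≤ 1 ∧
      2 * d / R + ρ / (1 - γ) * ((((R : ℝ) ^ d)⁻¹) ^ (γ - 1) - 1) <
        ρ / (1 - γ) * (s ^ (γ - 1) - 1) by
    obtain ⟨R, s, hR, hs, hs1, hlt⟩ := H
    obtain ⟨q, hq, hqF⟩ := exists_isProb_FDB_le (d := d) hR hρ hγ1
    refine ⟨s, hs, hs1, ((chiDB_le hq).trans hqF).trans_lt ?_⟩
    refine (ENNReal.ofReal_lt_ofReal_iff_of_nonneg ?_).2 hlt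
    have : (1 : ℝ) ≤ R := by exact_mod_cast hR
    exact add_nonneg (by positivity) (slope_nonneg hρ hγ1 (by positivity)
      (inv_le_one_of_one_le₀ (one_le_pow₀ this)))
  rcases lt_or_gt_of_ne hγ1 with h | h
  · have hc : 0 < ρ / (1 - γ) := div_pos hρ (by linarith)
    set K : ℝ := 1 + (2 * d + 1) / (ρ / (1 - γ)) with hK
    have hK1 : 1 ≤ K := by
      have : 0 < (2 * d + 1) / (ρ / (1 - γ)) := by positivity
      linarith
    refine ⟨1, K ^ (γ - 1)⁻¹, le_rfl, by positivity,
      Real.rpow_le_one_of_one_le_of_nonpos hK1 (inv_nonpos.2 (by linarith)), ?_⟩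
    rw [Real.rpow_inv_rpow (by positivity) (by linarith), hK]
    simp only [Nat.cast_one, one_pow, inv_one, Real.one_rpow, sub_self, mul_zero, add_sub_cancel_left]
    rw [mul_div_cancel₀ _ hc.ne']
    linarith
  · set a := ρ / (γ - 1) with ha
    have hca : ρ / (1 - γ) = -a := by rw [ha, ← div_neg, neg_sub]
    have ha0 : 0 < a := div_pos hρ (by linarith)
    obtain ⟨R, hR, hlt⟩ : ∃ R : ℕ, 1 ≤ R ∧ 2 * d / R < a * (((R : ℝ) ^ d)⁻¹) ^ (γ - 1) := by
      rcases lt_max_iff.1 hγ with h1 | h1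
      · have hexp : 0 < 1 - d * (γ - 1) := by
          have : (γ - 1) < 1 / d := by linarith
          rw [lt_div_iff₀ hd0] at this
          linarith
        have ht := (tendsto_rpow_atTop hexp).comp tendsto_natCast_atTop_atTop
        obtain ⟨R, hRl, hR⟩ := ((ht.eventually_gt_atTop (2 * d / a)).and
          (eventually_ge_atTop 1)).exists
        have hR0 : (0 : ℝ) < R := by exact_mod_cast hR
        refine ⟨R, hR, ?_⟩
        simp only [Function.comp_apply] at hRl
        rw [Real.inv_rpow (by positivity), ← Real.rpow_natCast_mul hR0.le, div_lt_iff₀ hR0]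
        rw [Real.rpow_sub hR0, Real.rpow_one, div_lt_iff₀ ha0] at hRl
        calc _ < _ := hRl
          _ = _ := by ring
      · refine ⟨1, le_rfl, ?_⟩
        have : (γ - 1) < ρ / (2 * d) := by linarith
        rw [lt_div_iff₀ (by positivity)] at this
        simp only [Nat.cast_one, one_pow, inv_one, Real.one_rpow, div_one, mul_one]
        rw [ha, lt_div_iff₀ (by linarith)]
        linarith
    set η : ℝ := (a * (((R : ℝ) ^ d)⁻¹) ^ (γ - 1) - 2 * d / R) / (2 * a) with hη
    have hR1 : (1 : ℝ) ≤ R := by exact_mod_cast hR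
    have hb1 : (((R : ℝ) ^ d)⁻¹) ^ (γ - 1) ≤ 1 := Real.rpow_le_one (by positivity)
      (inv_le_one_of_one_le₀ (one_le_pow₀ hR1)) (by linarith)
    have hη0 : 0 < η := div_pos (by linarith) (by linarith)
    have hη2 : 2 * (a * η) = a * (((R : ℝ) ^ d)⁻¹) ^ (γ - 1) - 2 * d / R := by
      rw [hη]; field_simp
    have hη1 : η ≤ 1 := by
      have : (0 : ℝ) ≤ 2 * d / R := by positivity
      by_contra! hc
      nlinarith
    refine ⟨R, η ^ (γ - 1)⁻¹, hR, by positivity,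
      Real.rpow_le_one hη0.le hη1 (inv_nonneg.2 (by linarith)), ?_⟩
    rw [Real.rpow_inv_rpow hη0.le (by linarith), hca]
    nlinarith [mul_pos ha0 hη0]

/-- Existence of a minimiser for `χ^{DB}_γ(ρ)`. -/
theorem stmt3 (d : ℕ) (hd : 1 ≤ d) (ρ γ : ℝ) (hρ : 0 < ρ) (hγ0 : 0 ≤ γ) (hγ1 : γ ≠ 1)
    (hγ : γ < max (1 + 1 / (d:ℝ)) (1 + ρ / (2 * d))) :
    ∃ p : Zd d → ℝ, IsProb p ∧ ∀ q : Zd d → ℝ, IsProb q → FDB γ ρ p ≤ FDB γ ρ q := by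
  obtain ⟨s, hs, hs1, hI⟩ := exists_chiDB_lt hd hρ hγ1 hγ
  obtain ⟨p, hp, hle⟩ := exists_isProb_FDB_le_chiDB hρ hγ0 hγ1 hs hs1 hI
  exact ⟨p, hp, fun q hq => hle.trans (chiDB_le hq)⟩
end

section
/- Let d ≥ 1 and γ ≥ 0 with γ ≠ 1. Then lim_{ρ→∞} χ^{DB}_γ(ρ) = 2d. -/
open MeasureTheory Filter
open scoped ENNReal NNReal Topology

/-- The `2d` unit vectors of `ℤ^d`. -/
def unitVec {d : ℕ} (q : Fin d × Bool) : Zd d := Pi.single q.1 (if q.2 then 1 else -1)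

/-- The `4d` ordered pairs of neighbouring sites containing `z₀`. -/
def incidentEdge {d : ℕ} (z₀ : Zd d) (e : (Fin d × Bool) × Bool) : Zd d × Zd d :=
  if e.2 then (z₀, z₀ + unitVec e.1) else (z₀ + unitVec e.1, z₀)

lemma sum_abs_unitVec {d : ℕ} (q : Fin d × Bool) : ∑ i, |unitVec q i| = 1 := by
  rw [Finset.sum_eq_single q.1]
  · rcases q with ⟨i, _ | _⟩ <;> simp [unitVec]
  · intro i _ hi
    simp [unitVec, Pi.single_eq_of_ne hi]
  · simp

lemma unitVec_ne_zero {d : ℕ} (q : Fin d × Bool) : unitVec q ≠ 0 := by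
  intro h
  simpa [h] using sum_abs_unitVec q

lemma unitVec_injective {d : ℕ} : Function.Injective (unitVec (d := d)) := by
  rintro ⟨i, a⟩ ⟨j, b⟩ h
  have h1 := congrFun h i
  by_cases hij : i = j
  · subst hij
    cases a <;> cases b <;> simp_all [unitVec]
  · simp only [unitVec, Pi.single_eq_same, Pi.single_eq_of_ne hij] at h1
    cases a <;> simp at h1

lemma exists_eq_unitVec {d : ℕ} {x : Zd d} (hx : ∑ i, |x i| = 1) : ∃ q, unitVec q = x := by
  obtain ⟨i, hi⟩ : ∃ i, x i ≠ 0 := by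
    by_contra! h
    simp [h] at hx
  have hsplit := Finset.add_sum_erase Finset.univ (fun i => |x i|) (Finset.mem_univ i)
  have hpos : 1 ≤ |x i| := Int.one_le_abs hi
  have hnonneg : 0 ≤ ∑ j ∈ Finset.univ.erase i, |x j| := Finset.sum_nonneg fun j _ => abs_nonneg _
  have hrest : ∑ j ∈ Finset.univ.erase i, |x j| = 0 := by omega
  have hone : |x i| = 1 := by omega
  have hz : ∀ j, j ≠ i → x j = 0 := fun j hj => by
    have := (Finset.sum_eq_zero_iff_of_nonneg fun j _ => abs_nonneg (x j)).1 hrest j (by simp [hj])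
    simpa using this
  rcases eq_or_eq_neg_of_abs_eq hone with h | h
  · refine ⟨(i, true), funext fun j => ?_⟩
    by_cases hj : j = i
    · subst hj; simp [unitVec, h]
    · simp [unitVec, Pi.single_eq_of_ne hj, hz j hj]
  · refine ⟨(i, false), funext fun j => ?_⟩
    by_cases hj : j = i
    · subst hj; simp [unitVec, h]
    · simp [unitVec, Pi.single_eq_of_ne hj, hz j hj]

lemma incidentEdge_injective {d : ℕ} (z₀ : Zd d) : Function.Injective (incidentEdge z₀) := by
  rintro ⟨q, a⟩ ⟨r, b⟩ h
  have hq := unitVec_ne_zero q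
  have hr := unitVec_ne_zero r
  cases a <;> cases b <;> simp_all [incidentEdge, unitVec_injective.eq_iff]

lemma dirS_eq_tsum_prod {d : ℕ} (p : Zd d → ℝ) :
    dirS p = 2⁻¹ * ∑' e : Zd d × Zd d, if (∑ i, |e.2 i - e.1 i|) = 1 then
      ENNReal.ofReal ((Real.sqrt (p e.2) - Real.sqrt (p e.1)) ^ 2) else 0 := by
  rw [dirS, ENNReal.tsum_prod']

lemma half_mul_sum_const (d : ℕ) (v : ℝ≥0∞) :
    2⁻¹ * ∑' _ : (Fin d × Bool) × Bool, v = 2 * d * v := by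
  rw [tsum_fintype, Finset.sum_const, Finset.card_univ, nsmul_eq_mul]
  simp only [Fintype.card_prod, Fintype.card_fin, Fintype.card_bool]
  push_cast
  have h : (2⁻¹ : ℝ≥0∞) * 2 = 1 := ENNReal.inv_mul_cancel (by simp) (by simp)
  calc (2⁻¹ : ℝ≥0∞) * (d * 2 * 2 * v) = (2⁻¹ * 2) * (2 * d * v) := by ring
    _ = 2 * d * v := by rw [h, one_mul]

/-- If the square-root increments at `z₀` are all at least `s`, the Dirichlet form is at least
`2d s²`. -/
lemma le_dirS {d : ℕ} (p : Zd d → ℝ) (z₀ : Zd d) {s : ℝ} (hs : 0 ≤ s)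
    (h : ∀ x, x ≠ z₀ → s ≤ √(p z₀) - √(p x)) :
    2 * d * ENNReal.ofReal (s ^ 2) ≤ dirS p := by
  rw [dirS_eq_tsum_prod, ← half_mul_sum_const]
  gcongr
  refine le_trans (ENNReal.tsum_le_tsum fun e => ?_)
    (ENNReal.tsum_comp_le_tsum_of_injective (incidentEdge_injective z₀) _)
  obtain ⟨q, b⟩ := e
  have hne : z₀ + unitVec q ≠ z₀ := by simpa using unitVec_ne_zero q
  have hsq := pow_le_pow_left₀ hs (h _ hne) 2
  cases b
  · simpa [incidentEdge, sum_abs_unitVec] using ENNReal.ofReal_le_ofReal hsq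
  · rw [← neg_sub, neg_sq] at hsq
    simpa [incidentEdge, sum_abs_unitVec] using ENNReal.ofReal_le_ofReal hsq

lemma dirS_single {d : ℕ} : dirS (Pi.single (0 : Zd d) (1 : ℝ)) = 2 * d := by
  rw [dirS_eq_tsum_prod, ← (incidentEdge_injective (0 : Zd d)).tsum_eq]
  · rw [← mul_one (2 * (d : ℝ≥0∞)), ← half_mul_sum_const]
    congr 2
    funext e
    obtain ⟨q, b⟩ := e
    cases b <;>
      simp [incidentEdge, sum_abs_unitVec, Pi.single_eq_of_ne (unitVec_ne_zero q)]
  · rintro ⟨z, x⟩ hzx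
    simp only [Function.mem_support, ne_eq, ite_eq_right_iff, Classical.not_imp] at hzx
    obtain ⟨hadj, hval⟩ := hzx
    by_cases hz : z = 0
    · subst hz
      obtain ⟨q, rfl⟩ := exists_eq_unitVec (x := x) (by simpa using hadj)
      exact ⟨(q, true), by simp [incidentEdge]⟩
    · by_cases hx : x = 0
      · subst hx
        obtain ⟨q, rfl⟩ := exists_eq_unitVec (x := z) (by simpa using hadj)
        exact ⟨(q, false), by simp [incidentEdge]⟩
      · simp [Pi.single_eq_of_ne hz, Pi.single_eq_of_ne hx] at hval

lemma chiDB_le_s6 (d : ℕ) (γ ρ : ℝ) : chiDB d γ ρ ≤ 2 * d := by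
  have hp : IsProb (Pi.single (0 : Zd d) (1 : ℝ)) :=
    ⟨fun z => (Pi.single_nonneg (i := (0 : Zd d)).2 zero_le_one : (0 : Zd d → ℝ) ≤ _) z, by
      have h := hasSum_single (f := (Pi.single 0 1 : Zd d → ℝ)) 0
        fun z hz => Pi.single_eq_of_ne hz _
      rwa [Pi.single_eq_same] at h⟩
  refine (iInf_le _ ⟨_, hp⟩).trans ?_
  have hzero : ∀ z : Zd d, ENNReal.ofReal (ρ / (1 - γ) *
      (mpow ((Pi.single 0 1 : Zd d → ℝ) z) γ - (Pi.single 0 1 : Zd d → ℝ) z)) = 0 := by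
    intro z
    by_cases hz : z = 0
    · subst hz; simp [mpow]
    · simp [mpow, Pi.single_eq_of_ne hz]
  simp only [FDB, hzero, tsum_zero, add_zero, dirS_single, le_refl]

/-- The density of the penalty, `(t^(γ-1) - 1) / (1 - γ)`, is positive for `t < 1`. -/
lemma rpow_sub_one_div_pos {γ t : ℝ} (hγ : γ ≠ 1) (ht : 0 < t) (ht1 : t < 1) :
    0 < (t ^ (γ - 1) - 1) / (1 - γ) := by
  rcases lt_or_gt_of_ne hγ with h | h
  · exact div_pos (by linarith [Real.one_lt_rpow_of_pos_of_lt_one_of_neg ht ht1 (sub_neg.2 h)])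
      (by linarith)
  · exact div_pos_of_neg_of_neg (by linarith [Real.rpow_lt_one ht.le ht1 (sub_pos.2 h)])
      (by linarith)

lemma mul_le_penalty {γ t x : ℝ} (hγ : γ ≠ 1) (hx : 0 ≤ x) (hxt : x ≤ t) :
    (t ^ (γ - 1) - 1) / (1 - γ) * x ≤ (mpow x γ - x) / (1 - γ) := by
  rcases hx.eq_or_lt with rfl | hx
  · simp [mpow]
  have hmul : mpow x γ = x ^ (γ - 1) * x := by
    rw [mpow, if_neg hx.ne', Real.rpow_sub_one hx.ne', div_mul_cancel₀ _ hx.ne']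
  have hrw : (mpow x γ - x) / (1 - γ) = (x ^ (γ - 1) - 1) / (1 - γ) * x := by
    rw [hmul]; ring
  rw [hrw]
  refine mul_le_mul_of_nonneg_right ?_ hx.le
  rcases lt_or_gt_of_ne hγ with h | h
  · have := Real.rpow_le_rpow_of_nonpos hx hxt (sub_neg.2 h).le
    exact div_le_div_of_nonneg_right (by linarith) (by linarith)
  · have := Real.rpow_le_rpow hx.le hxt (sub_pos.2 h).le
    exact div_le_div_of_nonpos_of_le (by linarith) (by linarith)

lemma ofReal_le_penalty {d : ℕ} {γ ρ t : ℝ} (hγ : γ ≠ 1) (hρ : 0 ≤ ρ) (ht : 0 < t) (ht1 : t < 1)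
    {p : Zd d → ℝ} (hp : IsProb p) (hpt : ∀ z, p z ≤ t) :
    ENNReal.ofReal (ρ * ((t ^ (γ - 1) - 1) / (1 - γ))) ≤
      ∑' z : Zd d, ENNReal.ofReal (ρ / (1 - γ) * (mpow (p z) γ - p z)) := by
  have hc := mul_nonneg hρ (rpow_sub_one_div_pos hγ ht ht1).le
  calc ENNReal.ofReal (ρ * ((t ^ (γ - 1) - 1) / (1 - γ)))
      = ∑' z, ENNReal.ofReal (ρ * ((t ^ (γ - 1) - 1) / (1 - γ))) * ENNReal.ofReal (p z) := by
        rw [ENNReal.tsum_mul_left, ← ENNReal.ofReal_tsum_of_nonneg hp.1 hp.2.summable,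
          hp.2.tsum_eq, ENNReal.ofReal_one, mul_one]
    _ ≤ _ := by
        refine ENNReal.tsum_le_tsum fun z => ?_
        rw [← ENNReal.ofReal_mul hc]
        refine ENNReal.ofReal_le_ofReal ?_
        have := mul_le_mul_of_nonneg_left (mul_le_penalty hγ (hp.1 z) (hpt z)) hρ
        calc _ = ρ * ((t ^ (γ - 1) - 1) / (1 - γ) * p z) := by ring
          _ ≤ _ := this
          _ = _ := by ring

lemma dirichlet_le_FDB_of_lt {d : ℕ} (γ ρ : ℝ) {δ : ℝ} (hδ : δ ≤ 1 / 2) {p : Zd d → ℝ}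
    (hp : IsProb p) {z₀ : Zd d} (hz₀ : 1 - δ < p z₀) :
    2 * d * ENNReal.ofReal ((√(1 - δ) - √δ) ^ 2) ≤ FDB γ ρ p := by
  refine (le_dirS p z₀ (sub_nonneg.2 (Real.sqrt_le_sqrt (by linarith))) fun x hx => ?_).trans
    le_self_add
  have hsum := sum_le_hasSum {z₀, x} (fun z _ => hp.1 z) hp.2
  rw [Finset.sum_pair hx.symm] at hsum
  exact sub_le_sub (Real.sqrt_le_sqrt hz₀.le) (Real.sqrt_le_sqrt (by linarith))

/-- `χ^{DB}_γ(ρ) → 2d` as `ρ → ∞`. -/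
theorem stmt6 (d : ℕ) (hd : 1 ≤ d) (γ : ℝ) (hγ0 : 0 ≤ γ) (hγ1 : γ ≠ 1) :
    Tendsto (fun ρ : ℝ => chiDB d γ ρ) atTop (𝓝 (2 * d : ℝ≥0∞)) := by
  refine tendsto_order.2 ⟨fun a ha => ?_,
    fun a ha => Eventually.of_forall fun ρ => (chiDB_le_s6 d γ ρ).trans_lt ha⟩
  have hlim : Tendsto (fun δ : ℝ => 2 * d * ENNReal.ofReal ((√(1 - δ) - √δ) ^ 2)) (𝓝[>] 0)
      (𝓝 (2 * d : ℝ≥0∞)) := by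
    have hcont : Continuous fun δ : ℝ => ENNReal.ofReal ((√(1 - δ) - √δ) ^ 2) :=
      ENNReal.continuous_ofReal.comp (by fun_prop)
    have h1 := ENNReal.Tendsto.const_mul (a := 2 * (d : ℝ≥0∞)) (hcont.tendsto 0)
      (Or.inr (ENNReal.mul_ne_top (by simp) (by simp)))
    simpa using h1.mono_left nhdsWithin_le_nhds
  obtain ⟨δ, hδa, hδ0, hδ2⟩ := ((hlim.eventually (lt_mem_nhds ha)).and
    (Ioo_mem_nhdsGT (show (0 : ℝ) < 1 / 2 by norm_num))).exists
  have hc := rpow_sub_one_div_pos hγ1 (show 0 < 1 - δ by linarith) (by linarith)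
  have hpen := ENNReal.tendsto_ofReal_atTop.comp (tendsto_id.atTop_mul_const hc)
  have htop : 2 * d * ENNReal.ofReal ((√(1 - δ) - √δ) ^ 2) < ∞ :=
    ENNReal.mul_lt_top (ENNReal.mul_lt_top (by simp) (by simp)) ENNReal.ofReal_lt_top
  filter_upwards [hpen.eventually (lt_mem_nhds htop), eventually_ge_atTop 0] with ρ hρ hρ0
  refine hδa.trans_le (le_iInf fun ⟨p, hp⟩ => ?_)
  by_cases h : ∃ z₀, 1 - δ < p z₀
  · obtain ⟨z₀, hz₀⟩ := h
    exact dirichlet_le_FDB_of_lt γ ρ hδ2.le hp hz₀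
  · push Not at h
    exact hρ.le.trans ((ofReal_le_penalty hγ1 hρ0 (by linarith) (by linarith) hp h).trans
      le_add_self)
end
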